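/- arXiv:1311.3166 — 2 statements merged into one kernel-verified Lean document; each statement's English description precedes it below -/
import Mathlib

section
/- Let ℓ be a prime, q a power of a prime p ≠ ℓ, and r an integer. Let X be a bounded cochain complex of ℤ_ℓ-modules whose cohomology modules H^j(X) are finitely generated over ℤ_ℓ, and let γ : X → X be an automorphism of complexes. Set γ_r = q^{−r}·γ and E^j = H^{j−1}(Cone(1 − γ_r : X → X)), so that there are short exact sequences 0 → Coker(1 − γ_r | H^{j−1}(X)) → E^j → Ker(1 − γ_r | H^j(X)) → 0. Assume that for every j, q^r is not a multiple root of the minimal polynomial of γ on H^j(X) ⊗ ℚ_ℓ. Let f^j : Ker(1 − γ_r | H^j(X)) → Coker(1 − γ_r | H^j(X)) be induced by the identity of H^j(X), and define d^j : E^j → E^{j+1} as the composite of the surjection E^j → Ker(1 − γ_r | H^j(X)), the map f^j, and the injection Coker(1 − γ_r | H^j(X)) → E^{j+1}. Then (E^•, d^•) is a complex whose cohomology groups are finite, and the alternating product χ^× of their orders satisfies χ^× = | ∏_j ( ∏_{i : a_{j,i} ≠ q^r} (1 − a_{j,i}/q^r) )^{(−1)^{j+1}} |_ℓ^{−1}, where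 (a_{j,i})_i is the family of eigenvalues (with multiplicity, in a fixed algebraic closure of ℚ_ℓ) of γ acting on H^j(X) ⊗ ℚ_ℓ and | · |_ℓ is the ℓ-adic absolute value normalized by |ℓ|_ℓ = ℓ^{−1}. -/
open scoped TensorProduct

/-- The cohomology of a graded complex at degree `j`: the complex is presented as an
ambient module `V` with grading `X : ℤ → Submodule R V` and a differential
`D : V →ₗ[R] V` mapping `X i` into `X (i+1)`; the cohomology at `j` is
`(X j ∩ Ker D) / D (X (j-1))`. -/
abbrev gradedCoh {R V : Type*} [CommRing R] [AddCommGroup V] [Module R V]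
    (X : ℤ → Submodule R V) (D : V →ₗ[R] V) (j : ℤ) : Type _ :=
  ↥(X j ⊓ LinearMap.ker D) ⧸
    Submodule.comap (X j ⊓ LinearMap.ker D).subtype (Submodule.map D (X (j - 1)))

/-- The characteristic polynomial of an endomorphism of a finite-dimensional space
(with the finiteness hypothesis supplied explicitly). -/
noncomputable def charpolyOfFinite {K M : Type*} [Field K] [AddCommGroup M]
    [Module K M] (hfin : Module.Finite K M) (f : M →ₗ[K] M) : Polynomial K :=
  letI := hfin
  LinearMap.charpoly f


open Module Submodule in
theorem cc_card_quot_span (ℓ : ℕ) [Fact ℓ.Prime] (a : ℤ_[ℓ]) (ha : a ≠ 0) :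
    (Nat.card (ℤ_[ℓ] ⧸ Ideal.span ({a} : Set ℤ_[ℓ])) : ℝ) = ‖a‖⁻¹ := by
  have h1 : Ideal.span ({a} : Set ℤ_[ℓ]) = RingHom.ker (PadicInt.toZModPow (p := ℓ) a.valuation) := by
    rw [PadicInt.ker_toZModPow]
    rw [Ideal.span_singleton_eq_span_singleton]
    refine Associated.symm ⟨PadicInt.unitCoeff ha, ?_⟩
    conv_rhs => rw [PadicInt.unitCoeff_spec ha]
    rw [mul_comm]
  have hs : Function.Surjective (PadicInt.toZModPow (p := ℓ) a.valuation) := ZMod.ringHom_surjective _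
  rw [Nat.card_congr ((Ideal.quotEquivOfEq h1).trans
    (RingHom.quotientKerEquivOfSurjective hs)).toEquiv, Nat.card_zmod,
    PadicInt.norm_eq_zpow_neg_valuation ha]
  simp

open Module Submodule in
theorem cc_card_free (ℓ : ℕ) [Fact ℓ.Prime] {F : Type*} [AddCommGroup F] [Module ℤ_[ℓ] F]
    [Module.Free ℤ_[ℓ] F] [Module.Finite ℤ_[ℓ] F] (φ : F →ₗ[ℤ_[ℓ]] F)
    (hφ : Function.Injective φ) :
    (Nat.card (F ⧸ LinearMap.range φ) : ℝ) = ‖LinearMap.det φ‖⁻¹ := by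
  set N := LinearMap.range φ with hN
  let e : F ≃ₗ[ℤ_[ℓ]] N := LinearEquiv.ofInjective φ hφ
  let b := Module.Free.chooseBasis ℤ_[ℓ] F
  have h : Module.finrank ℤ_[ℓ] N = Module.finrank ℤ_[ℓ] F := e.symm.finrank_eq
  let a := smithNormalFormCoeffs b h
  let b' := smithNormalFormTopBasis b h
  let ab := smithNormalFormBotBasis b h
  have ab_eq := smithNormalFormBotBasis_def b h
  let e' : F ≃ₗ[ℤ_[ℓ]] N := b'.equiv ab (Equiv.refl _)
  let f : F →ₗ[ℤ_[ℓ]] F := N.subtype.comp (e' : F →ₗ[ℤ_[ℓ]] N)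
  let f_apply : ∀ x, f x = b'.equiv ab (Equiv.refl _) x := fun x ↦ rfl
  have hφe : φ = N.subtype ∘ₗ (e : F →ₗ[ℤ_[ℓ]] N) := by
    ext x
    exact (LinearEquiv.ofInjective_apply (h := hφ) φ x).symm
  have hassoc : Associated (LinearMap.det φ) (LinearMap.det f) := by
    rw [hφe]; exact LinearMap.associated_det_comp_equiv _ _ _
  have hnorm : ‖LinearMap.det φ‖ = ‖LinearMap.det f‖ := by
    obtain ⟨u, hu⟩ := hassoc
    rw [← hu, norm_mul, PadicInt.norm_units, mul_one]
  have ha : ∀ i, f (b' i) = a i • b' i := by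
    intro i
    rw [f_apply, b'.equiv_apply, Equiv.refl_apply]
    exact ab_eq i
  have hdet : LinearMap.det f = ∏ i, a i := by
    rw [← LinearMap.det_toMatrix b', ← Matrix.det_diagonal]
    congr 1; ext i j
    rw [LinearMap.toMatrix_apply, ha, map_smul, Basis.repr_self, Finsupp.smul_single,
      smul_eq_mul, mul_one]
    by_cases h : i = j
    · rw [h, Matrix.diagonal_apply_eq, Finsupp.single_eq_same]
    · rw [Matrix.diagonal_apply_ne _ h, Finsupp.single_eq_of_ne h]
  rw [hnorm, hdet, norm_prod, Nat.card_congr (quotientEquivPiSpan N b h).toEquiv, Nat.card_pi,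
    Nat.cast_prod, ← Finset.prod_inv_distrib]
  exact Finset.prod_congr rfl fun i _ => cc_card_quot_span ℓ _ (smithNormalFormCoeffs_ne_zero b h i)

theorem cc_finite_torsion (ℓ : ℕ) [Fact ℓ.Prime] {T : Type*} [AddCommGroup T] [Module ℤ_[ℓ] T]
    [Module.Finite ℤ_[ℓ] T] (h : ∀ x : T, ∃ a : ℤ_[ℓ], a ≠ 0 ∧ a • x = 0) : Finite T := by
  classical
  obtain ⟨S, hS⟩ := Module.Finite.fg_top (R := ℤ_[ℓ]) (M := T)
  choose a ha0 ha using h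
  set A : ℤ_[ℓ] := ∏ s ∈ S, a s with hA
  have hA0 : A ≠ 0 := Finset.prod_ne_zero_iff.2 fun i _ => ha0 i
  have hAT : ∀ x : T, A • x = 0 := by
    intro x
    have hx : x ∈ Submodule.span ℤ_[ℓ] (S : Set T) := hS ▸ Submodule.mem_top
    induction hx using Submodule.span_induction with
    | mem x hx =>
      rw [hA, ← Finset.prod_erase_mul S a hx, mul_smul, ha, smul_zero]
    | zero => simp
    | add x y _ _ h1 h2 => rw [smul_add, h1, h2, add_zero]
    | smul c x _ h1 => rw [smul_comm, h1, smul_zero]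
  have hfin : Finite (ℤ_[ℓ] ⧸ Ideal.span ({A} : Set ℤ_[ℓ])) := by
    apply Nat.finite_of_card_ne_zero
    have := cc_card_quot_span ℓ A hA0
    intro h0
    rw [h0] at this
    have h2 : ‖A‖ ≠ 0 := norm_ne_zero_iff.2 hA0
    rw [Nat.cast_zero, eq_comm, inv_eq_zero] at this
    exact h2 this
  -- T is a module over the quotient
  have hle : ∀ y : T, Ideal.span ({A} : Set ℤ_[ℓ]) ≤ LinearMap.ker (LinearMap.toSpanSingleton ℤ_[ℓ] T y) := by
    intro y
    rw [Ideal.span_le]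
    rintro _ rfl
    simpa using hAT y
  let g : (S → (ℤ_[ℓ] ⧸ Ideal.span ({A} : Set ℤ_[ℓ]))) → T :=
    fun c => ∑ s : S, Submodule.liftQ _ (LinearMap.toSpanSingleton ℤ_[ℓ] T (s : T)) (hle s) (c s)
  refine Finite.of_surjective g ?_
  intro x
  have hx : x ∈ Submodule.span ℤ_[ℓ] (S : Set T) := hS ▸ Submodule.mem_top
  rw [Submodule.mem_span_finset'] at hx
  obtain ⟨c, hc⟩ := hx
  refine ⟨fun s => Submodule.Quotient.mk (c s), ?_⟩
  simp only [g]
  rw [← hc]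
  exact Finset.sum_congr rfl fun s _ => by
    rw [Submodule.liftQ_apply, LinearMap.toSpanSingleton_apply]

theorem cc_index_eq {R M : Type*} [Ring R] [AddCommGroup M] [Module R M] (N : Submodule R M) :
    N.toAddSubgroup.index = Nat.card (M ⧸ N) := rfl

theorem cc_index_lemma {R N F : Type*} [Ring R] [AddCommGroup N] [Module R N] [AddCommGroup F]
    [Module R F] (g : N →ₗ[R] F) (hg : Function.Surjective g) (hTfin : Finite (LinearMap.ker g))
    (φ : N →ₗ[R] N) (φF : F →ₗ[R] F) (hc : ∀ x, g (φ x) = φF (g x)) (hφF : Function.Injective φF) :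
    Nat.card (N ⧸ LinearMap.range φ) = Nat.card (LinearMap.ker φ) * Nat.card (F ⧸ LinearMap.range φF) := by
  have hker : LinearMap.ker φ ≤ LinearMap.ker g := by
    intro x hx
    have := hc x
    rw [LinearMap.mem_ker.1 hx, map_zero] at this
    exact hφF (by rw [← this, map_zero])
  have e1 : (LinearMap.range φ ⊔ LinearMap.ker g).toAddSubgroup.index = Nat.card (F ⧸ LinearMap.range φF) := by
    rw [← cc_index_eq]
    have : (LinearMap.range φ ⊔ LinearMap.ker g) = Submodule.comap g (LinearMap.range φF) := by
      have : LinearMap.range φF = Submodule.map g (LinearMap.range φ) := by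
        ext y
        obtain ⟨x, rfl⟩ := hg y
        constructor
        · rintro ⟨w, hz⟩
          obtain ⟨z, rfl⟩ := hg w
          exact ⟨φ z, ⟨z, rfl⟩, by rw [← hz, hc]⟩
        · rintro ⟨_, ⟨z, rfl⟩, hz⟩
          exact ⟨g z, by rw [← hz, hc]⟩
      rw [this, Submodule.comap_map_eq]
    rw [this]
    exact AddSubgroup.index_comap_of_surjective (LinearMap.range φF).toAddSubgroup (f := g.toAddMonoidHom) hg
  have e2 : (LinearMap.range φ).toAddSubgroup.relIndex (LinearMap.ker g).toAddSubgroup * (LinearMap.range φ ⊔ LinearMap.ker g).toAddSubgroup.index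
      = (LinearMap.range φ).toAddSubgroup.index := by
    rw [← AddSubgroup.relIndex_mul_index (H := (LinearMap.range φ).toAddSubgroup)
      (K := (LinearMap.range φ ⊔ LinearMap.ker g).toAddSubgroup) (by exact (le_sup_left : LinearMap.range φ ≤ _)),
      Submodule.sup_toAddSubgroup, AddSubgroup.relIndex_sup_left]
  have e3 : (LinearMap.range φ).toAddSubgroup.relIndex (LinearMap.ker g).toAddSubgroup = Nat.card (LinearMap.ker φ) := by
    have hcm : Submodule.comap φ (LinearMap.ker g) = LinearMap.ker g := by
      ext x
      simp only [Submodule.mem_comap, LinearMap.mem_ker, hc]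
      exact ⟨fun h => hφF (by rw [h, map_zero]), fun h => by rw [h, map_zero]⟩
    have hinf : LinearMap.range φ ⊓ LinearMap.ker g = Submodule.map φ (LinearMap.ker g) := by
      rw [← Submodule.map_comap_eq, hcm]
    have a1 : Nat.card ((LinearMap.range φ ⊓ LinearMap.ker g : Submodule R N).toAddSubgroup) * (LinearMap.range φ).toAddSubgroup.relIndex (LinearMap.ker g).toAddSubgroup = Nat.card (LinearMap.ker g).toAddSubgroup := by
      rw [← AddSubgroup.relIndex_bot_left, ← AddSubgroup.relIndex_bot_left, show (LinearMap.range φ ⊓ LinearMap.ker g).toAddSubgroup = (LinearMap.range φ).toAddSubgroup ⊓ (LinearMap.ker g).toAddSubgroup from rfl,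
        ← AddSubgroup.inf_relIndex_right (LinearMap.range φ).toAddSubgroup]
      exact AddSubgroup.relIndex_mul_relIndex _ _ _ bot_le inf_le_right
    have a2 : Nat.card ((Submodule.map φ (LinearMap.ker g)).toAddSubgroup) = (LinearMap.ker φ).toAddSubgroup.relIndex (LinearMap.ker g).toAddSubgroup := by
      exact (AddSubgroup.relIndex_ker (f := φ.toAddMonoidHom) (LinearMap.ker g).toAddSubgroup).symm
    have a3 : Nat.card (LinearMap.ker φ).toAddSubgroup * (LinearMap.ker φ).toAddSubgroup.relIndex (LinearMap.ker g).toAddSubgroup = Nat.card (LinearMap.ker g).toAddSubgroup := by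
      rw [← AddSubgroup.relIndex_bot_left, ← AddSubgroup.relIndex_bot_left]
      exact AddSubgroup.relIndex_mul_relIndex _ _ _ bot_le hker
    have h0 : Nat.card (LinearMap.ker g).toAddSubgroup ≠ 0 := by
      have : Finite (LinearMap.ker g).toAddSubgroup := hTfin
      exact Nat.card_pos.ne'
    rw [hinf, a2] at a1
    rw [← a3, mul_comm] at a1
    refine Nat.eq_of_mul_eq_mul_right (Nat.pos_of_ne_zero ?_) a1
    intro h
    rw [h, mul_zero] at a3
    exact h0 a3.symm
  rw [e1, e3, cc_index_eq] at e2
  exact e2.symm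

/-- Lemma A: `|ker φ| = |coker φ| * ‖det Φ‖`. -/
theorem cc_lemmaA (ℓ : ℕ) [Fact ℓ.Prime] {N W : Type*} [AddCommGroup N] [Module ℤ_[ℓ] N]
    [Module.Finite ℤ_[ℓ] N] [AddCommGroup W] [Module ℤ_[ℓ] W] [Module ℚ_[ℓ] W]
    [IsScalarTower ℤ_[ℓ] ℚ_[ℓ] W]
    (g : N →ₗ[ℤ_[ℓ]] W) (hg1 : ∀ x, g x = 0 → ∃ a : ℤ_[ℓ], a ≠ 0 ∧ a • x = 0)
    (hg2 : Submodule.span ℚ_[ℓ] (Set.range g) = ⊤)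
    (φ : N →ₗ[ℤ_[ℓ]] N) (Φ : W →ₗ[ℚ_[ℓ]] W) (hc : ∀ x, g (φ x) = Φ (g x))
    (hΦ : Function.Injective Φ) :
    Finite (LinearMap.ker φ) ∧ Finite (N ⧸ LinearMap.range φ) ∧
    (Nat.card (LinearMap.ker φ) : ℝ) = Nat.card (N ⧸ LinearMap.range φ) * ‖LinearMap.det Φ‖ := by
  classical
  have hTfin : Finite (LinearMap.ker g) := by
    apply cc_finite_torsion ℓ
    rintro ⟨x, hx⟩
    obtain ⟨a, ha, hax⟩ := hg1 x hx
    exact ⟨a, ha, Subtype.ext hax⟩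
  have hker : LinearMap.ker φ ≤ LinearMap.ker g := by
    intro x hx
    have := hc x
    rw [LinearMap.mem_ker.1 hx, map_zero] at this
    exact hΦ (by rw [← this, map_zero])
  have hkfin : Finite (LinearMap.ker φ) :=
    Finite.of_injective _ (Submodule.inclusion_injective hker)
  have htfW : Module.IsTorsionFree ℤ_[ℓ] W := Module.IsTorsionFree.trans_faithfulSMul ℤ_[ℓ] ℚ_[ℓ] W
  set F := LinearMap.range g with hF
  have hFf : Module.Finite ℤ_[ℓ] F := inferInstance
  have hFt : Module.IsTorsionFree ℤ_[ℓ] F := inferInstance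
  have hFfree : Module.Free ℤ_[ℓ] F := inferInstance
  have hmap : ∀ x ∈ F, (Φ.restrictScalars ℤ_[ℓ]) x ∈ F := by
    rintro _ ⟨x, rfl⟩
    exact ⟨φ x, hc x⟩
  let φF : F →ₗ[ℤ_[ℓ]] F := (Φ.restrictScalars ℤ_[ℓ]).restrict hmap
  have hφF : Function.Injective φF := by
    intro x y hxy
    exact Subtype.ext (hΦ (congrArg Subtype.val hxy))
  -- determinant
  have hdet : ‖LinearMap.det φF‖ = ‖LinearMap.det Φ‖ := by
    let b := Module.Free.chooseBasis ℤ_[ℓ] F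
    have hli : LinearIndependent ℚ_[ℓ] (fun i => (b i : W)) := by
      rw [← LinearIndependent.iff_fractionRing ℤ_[ℓ] ℚ_[ℓ]]
      exact b.linearIndependent.map' F.subtype (Submodule.ker_subtype _)
    have hsp : ⊤ ≤ Submodule.span ℚ_[ℓ] (Set.range fun i => (b i : W)) := by
      rw [← hg2, Submodule.span_le]
      rintro _ ⟨x, rfl⟩
      have : (⟨g x, x, rfl⟩ : F) ∈ Submodule.span ℤ_[ℓ] (Set.range b) := b.mem_span _
      have h2 := Submodule.mem_map_of_mem (f := F.subtype) this
      rw [Submodule.map_span, ← Set.range_comp] at h2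
      exact Submodule.span_le_restrictScalars ℤ_[ℓ] ℚ_[ℓ] _ h2
    let B := Module.Basis.mk hli hsp
    have hB : ∀ i, B i = (b i : W) := fun i => Module.Basis.mk_apply hli hsp i
    have hrep : ∀ (x : F) i, B.repr (x : W) i = algebraMap ℤ_[ℓ] ℚ_[ℓ] (b.repr x i) := by
      intro x i
      have h1 : (x : W) = ∑ j, (algebraMap ℤ_[ℓ] ℚ_[ℓ] (b.repr x j)) • B j := by
        conv_lhs => rw [← b.sum_repr x]
        rw [AddSubmonoidClass.coe_finsetSum]
        refine Finset.sum_congr rfl fun j _ => ?_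
        rw [hB, algebraMap_smul]
        rfl
      rw [h1, B.repr_sum_self]
    have hmat : LinearMap.toMatrix B B Φ = (algebraMap ℤ_[ℓ] ℚ_[ℓ]).mapMatrix (LinearMap.toMatrix b b φF) := by
      ext i j
      rw [RingHom.mapMatrix_apply, Matrix.map_apply, LinearMap.toMatrix_apply, LinearMap.toMatrix_apply, hB, ← hrep]
      rfl
    rw [← LinearMap.det_toMatrix B, hmat, ← RingHom.map_det, LinearMap.det_toMatrix]
    exact (PadicInt.padic_norm_e_of_padicInt _).symm
  have hcardF := cc_card_free ℓ φF hφF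
  rw [hdet] at hcardF
  have hdet0 : ‖LinearMap.det Φ‖ ≠ 0 := by
    rw [← hdet]
    intro h
    have := (LinearMap.det_eq_zero_iff_ker_ne_bot (f := φF)).1 (norm_eq_zero.1 h)
    exact this (LinearMap.ker_eq_bot.2 hφF)
  have e2 := cc_index_lemma g.rangeRestrict g.surjective_rangeRestrict
    (by rw [LinearMap.ker_rangeRestrict]; exact hTfin) φ φF (fun x => Subtype.ext (hc x)) hφF
  have hF0 : Nat.card (F ⧸ LinearMap.range φF) ≠ 0 := by
    intro h; rw [h] at hcardF; simp at hcardF; simp [hcardF] at hdet0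
  refine ⟨hkfin, ?_, ?_⟩
  · apply Nat.finite_of_card_ne_zero
    rw [e2]
    exact mul_ne_zero Nat.card_pos.ne' hF0
  · rw [e2]; push_cast; rw [hcardF, mul_assoc, inv_mul_cancel₀ hdet0, mul_one]

open Polynomial in
theorem cc_disjoint {K W : Type*} [Field K] [AddCommGroup W] [Module K W]
    [FiniteDimensional K W] (G : W →ₗ[K] W) (a : K)
    (hss : (minpoly K G).rootMultiplicity a ≤ 1) (x : W)
    (hx : G (G x - a • x) = a • (G x - a • x)) : G x = a • x := by
  have hne : minpoly K G ≠ 0 := minpoly.ne_zero (Algebra.IsIntegral.isIntegral G)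
  obtain ⟨h, hh, hnd⟩ := exists_eq_pow_rootMultiplicity_mul_and_not_dvd (minpoly K G) hne a
  have h1 : aeval G (h * (X - C a)) = 0 := by
    have h0 := minpoly.aeval K G
    rw [hh] at h0
    interval_cases hm : (minpoly K G).rootMultiplicity a
    · rw [pow_zero, one_mul] at h0
      rw [map_mul, h0, zero_mul]
    · rw [pow_one] at h0
      rw [mul_comm]; exact h0
  by_contra hne'
  have hv : Module.End.HasEigenvector G a (G x - a • x) := by
    refine ⟨Module.End.mem_eigenspace_iff.2 hx, sub_ne_zero.2 hne'⟩
  have h2 := Module.End.aeval_apply_of_hasEigenvector (p := h) hv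
  have h3 : aeval G h (G x - a • x) = 0 := by
    have := LinearMap.congr_fun h1 x
    rw [map_mul] at this
    simpa [Module.algebraMap_end_apply] using this
  rw [h3, eq_comm, smul_eq_zero] at h2
  rcases h2 with h2 | h2
  · exact hnd (dvd_iff_isRoot.2 h2)
  · exact hv.2 h2

theorem cc_mem_range_restrict {K W : Type*} [CommRing K] [AddCommGroup W] [Module K W]
    (Θ : W →ₗ[K] W) : ∀ x ∈ LinearMap.range Θ, Θ x ∈ LinearMap.range Θ := fun x _ => ⟨x, rfl⟩

open Polynomial in
theorem cc_lemmaB {K W : Type*} [Field K] [AddCommGroup W] [Module K W]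
    [FiniteDimensional K W] (G Θ : W →ₗ[K] W) (a : K) (ha : a ≠ 0)
    (hΘ : ∀ x, Θ x = x - a⁻¹ • G x)
    (hss : (minpoly K G).rootMultiplicity a ≤ 1) :
    Function.Injective (Θ.restrict (cc_mem_range_restrict Θ)) ∧
    RatFunc.eval (RingHom.id K) a⁻¹
          ((algebraMap (Polynomial K) (RatFunc K) (LinearMap.charpoly G).reverse) *
            (algebraMap (Polynomial K) (RatFunc K)
              (1 - Polynomial.C a * Polynomial.X)) ^
                (-((LinearMap.charpoly G).rootMultiplicity a : ℤ)))
      = LinearMap.det (Θ.restrict (cc_mem_range_restrict Θ)) := by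
  have hG : ∀ x, G x = a • (x - Θ x) := by
    intro x; rw [hΘ, sub_sub_cancel, smul_smul, mul_inv_cancel₀ ha, one_smul]
  have hdis : ∀ x, Θ (Θ x) = 0 → Θ x = 0 := by
    intro x hx
    have h1 : G x - a • x = - (a • Θ x) := by rw [hG, smul_sub]; abel
    have := cc_disjoint G a hss x (by
      rw [h1, hG, map_neg, map_smul, hx]; simp)
    rw [hΘ, this, smul_smul, inv_mul_cancel₀ ha, one_smul, sub_self]
  have hinj : Function.Injective (Θ.restrict (cc_mem_range_restrict Θ)) := by
    rw [← LinearMap.ker_eq_bot, LinearMap.ker_eq_bot']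
    rintro ⟨_, x, rfl⟩ hx
    exact Subtype.ext (hdis x (congrArg Subtype.val hx))
  refine ⟨hinj, ?_⟩
  have hcompl : IsCompl (LinearMap.ker Θ) (LinearMap.range Θ) := by
    rw [Submodule.isCompl_iff_disjoint]
    · rw [Submodule.disjoint_def]
      rintro _ hx ⟨x, rfl⟩
      exact hdis x hx
    · rw [add_comm, LinearMap.finrank_range_add_finrank_ker]
  have hGr : ∀ x ∈ LinearMap.range Θ, G x ∈ LinearMap.range Θ := by
    intro x hx
    rw [hG]
    exact Submodule.smul_mem _ _ (Submodule.sub_mem _ hx ⟨x, rfl⟩)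
  set Gr := G.restrict hGr with hGrdef
  set Θr := Θ.restrict (cc_mem_range_restrict Θ) with hΘr
  set n := Module.finrank K (LinearMap.ker Θ)
  set h := Gr.charpoly with hh
  have hchar : G.charpoly = (X - C a) ^ n * h := by
    have h1 : G = (Submodule.prodEquivOfIsCompl _ _ hcompl).conj
        (LinearMap.prodMap (0 - (-a) • (1 : Module.End K (LinearMap.ker Θ))) Gr) := by
      ext x
      obtain ⟨⟨y, z⟩, rfl⟩ := (Submodule.prodEquivOfIsCompl _ _ hcompl).surjective x
      rw [LinearEquiv.conj_apply_apply, LinearEquiv.symm_apply_apply]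
      have hy : Θ (y : W) = 0 := y.2
      have : G (y : W) = a • (y : W) := by rw [hG, hy, sub_zero]
      simp [Gr, this]
    rw [h1, LinearEquiv.charpoly_conj, LinearMap.charpoly_prodMap, LinearMap.charpoly_sub_smul,
      LinearMap.charpoly_zero]
    simp [sub_eq_add_neg, n, h]
  have heval : h.eval a = a ^ h.natDegree * LinearMap.det Θr := by
    rw [hh, LinearMap.eval_charpoly, LinearMap.charpoly_natDegree, ← LinearMap.det_smul]
    congr 1
    ext x
    simp [Gr, Θr, Module.algebraMap_end_apply, hΘ, smul_sub, smul_smul, ha]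
  have hdet : LinearMap.det Θr ≠ 0 := by
    intro h0
    exact (LinearMap.det_eq_zero_iff_ker_ne_bot.1 h0) (LinearMap.ker_eq_bot.2 hinj)
  have hea : h.eval a ≠ 0 := by rw [heval]; exact mul_ne_zero (pow_ne_zero _ ha) hdet
  have hh0 : h ≠ 0 := by rintro h0; rw [h0] at hea; simp at hea
  have hmult : G.charpoly.rootMultiplicity a = n := by
    rw [hchar, rootMultiplicity_mul (mul_ne_zero (pow_ne_zero _ (X_sub_C_ne_zero a)) hh0),
      rootMultiplicity_X_sub_C_pow, rootMultiplicity_eq_zero hea, add_zero]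
  have hrev1 : (X - C a : K[X]).reverse = 1 - C a * X := by
    rw [sub_eq_add_neg, ← C_neg]
    ext i
    simp only [reverse, natDegree_X_add_C, coeff_reflect]
    rcases i with _ | _ | i
    · rw [revAt_le (by omega)]
      simp [coeff_C]
    · rw [revAt_le (by omega)]
      simp [coeff_one]
    · rw [revAt_eq_self_of_lt (by omega)]
      simp [coeff_X, coeff_one]
  have hrevp : ∀ k : ℕ, ((X - C a : K[X]) ^ k).reverse = (1 - C a * X) ^ k := by
    intro k
    induction k with
    | zero => rw [pow_zero, pow_zero, ← C_1, reverse_C]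
    | succ k ih => rw [pow_succ, reverse_mul_of_domain, ih, hrev1, pow_succ]
  have hne : algebraMap K[X] (RatFunc K) (1 - C a * X) ≠ 0 := by
    refine RatFunc.algebraMap_ne_zero ?_
    intro h0
    have := congrArg (Polynomial.eval 0) h0
    simp at this
  rw [hmult, hchar, reverse_mul_of_domain, hrevp, map_mul, map_pow, zpow_neg, zpow_natCast,
    mul_comm, ← mul_assoc, inv_mul_cancel₀ (pow_ne_zero _ hne), one_mul, RatFunc.eval_algebraMap]
  have hinv : Invertible a := invertibleOfNonzero ha
  have h4 := eval₂_reverse_mul_pow (RingHom.id K) a h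
  rw [invOf_eq_inv] at h4
  have h5 : eval₂ (RingHom.id K) a h = h.eval a := rfl
  rw [h5, heval, mul_comm] at h4
  exact mul_left_cancel₀ (pow_ne_zero _ ha) h4

/-- Tate's lemma. -/
theorem cc_tate (ℓ : ℕ) [Fact ℓ.Prime] {M : Type*} [AddCommGroup M] [Module ℤ_[ℓ] M]
    [Module.Finite ℤ_[ℓ] M] (γ θ : M →ₗ[ℤ_[ℓ]] M) (a : ℚ_[ℓ]) (ha : a ≠ 0) (c : ℤ_[ℓ])
    (hca : (c : ℚ_[ℓ]) = a⁻¹) (hθ : ∀ x, θ x = x - c • γ x)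
    (hss : (minpoly ℚ_[ℓ] (LinearMap.baseChange ℚ_[ℓ] γ)).rootMultiplicity a ≤ 1) :
    Nat.card ↥(LinearMap.ker θ ⊓ LinearMap.range θ) ≠ 0 ∧
    Nat.card (M ⧸ (LinearMap.ker θ ⊔ LinearMap.range θ)) ≠ 0 ∧
    (Nat.card ↥(LinearMap.ker θ ⊓ LinearMap.range θ) : ℝ) =
      Nat.card (M ⧸ (LinearMap.ker θ ⊔ LinearMap.range θ)) *
      ‖RatFunc.eval (RingHom.id ℚ_[ℓ]) a⁻¹
          ((algebraMap (Polynomial ℚ_[ℓ]) (RatFunc ℚ_[ℓ]) (LinearMap.charpoly (LinearMap.baseChange ℚ_[ℓ] γ)).reverse) *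
            (algebraMap (Polynomial ℚ_[ℓ]) (RatFunc ℚ_[ℓ])
              (1 - Polynomial.C a * Polynomial.X)) ^
                (-((LinearMap.charpoly (LinearMap.baseChange ℚ_[ℓ] γ)).rootMultiplicity a : ℤ)))‖ := by
  set G := LinearMap.baseChange ℚ_[ℓ] γ with hG
  set Θ := LinearMap.baseChange ℚ_[ℓ] θ with hΘdef
  have hΘ : ∀ x, Θ x = x - a⁻¹ • G x := by
    intro x
    induction x using TensorProduct.induction_on with
    | zero => simp
    | add x y hx hy => rw [map_add, map_add, hx, hy, smul_add]; abel
    | tmul k m =>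
      rw [hΘdef, hG, LinearMap.baseChange_tmul, LinearMap.baseChange_tmul, hθ, TensorProduct.tmul_sub,
        ← hca, TensorProduct.tmul_smul]
      congr 1
  obtain ⟨hinj, hB⟩ := cc_lemmaB G Θ a ha hΘ hss
  rw [hB]
  set N := LinearMap.range θ with hN
  let φ : N →ₗ[ℤ_[ℓ]] N := θ.restrict (cc_mem_range_restrict θ)
  have hgm : ∀ x : N, (TensorProduct.mk ℤ_[ℓ] ℚ_[ℓ] M 1) (x : M) ∈ (LinearMap.range Θ).restrictScalars ℤ_[ℓ] := by
    rintro ⟨_, x, rfl⟩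
    exact ⟨(1 : ℚ_[ℓ]) ⊗ₜ x, by rw [hΘdef, LinearMap.baseChange_tmul]; rfl⟩
  let g : N →ₗ[ℤ_[ℓ]] LinearMap.range Θ :=
    LinearMap.codRestrict ((LinearMap.range Θ).restrictScalars ℤ_[ℓ])
      ((TensorProduct.mk ℤ_[ℓ] ℚ_[ℓ] M 1) ∘ₗ N.subtype) hgm
  have hg : ∀ x : N, (g x : ℚ_[ℓ] ⊗[ℤ_[ℓ]] M) = (1 : ℚ_[ℓ]) ⊗ₜ (x : M) := fun x => rfl
  have hΘt : ∀ (k : ℚ_[ℓ]) (m : M), Θ (k ⊗ₜ m) = k ⊗ₜ[ℤ_[ℓ]] (θ m) := fun k m => LinearMap.baseChange_tmul ..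
  have hA := cc_lemmaA ℓ g (by
      intro x hx
      have h1 : (TensorProduct.mk ℤ_[ℓ] ℚ_[ℓ] M 1) (x : M) = 0 := congrArg Subtype.val hx
      rw [IsLocalizedModule.eq_zero_iff (nonZeroDivisors ℤ_[ℓ])] at h1
      obtain ⟨s, hs⟩ := h1
      exact ⟨s, nonZeroDivisors.coe_ne_zero s, Subtype.ext hs⟩)
    (by
      rw [eq_top_iff]
      rintro ⟨_, x, rfl⟩ -
      induction x using TensorProduct.induction_on with
      | zero =>
        convert Submodule.zero_mem _
        exact Subtype.ext (map_zero Θ)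
      | add x y hx hy =>
        convert Submodule.add_mem _ hx hy
        exact Subtype.ext (map_add Θ _ _)
      | tmul k m =>
        have h2 := Submodule.smul_mem (Submodule.span ℚ_[ℓ] (Set.range g)) k
          (Submodule.subset_span ⟨(⟨θ m, m, rfl⟩ : N), rfl⟩)
        convert h2
        refine Subtype.ext ((hΘt k m).trans ?_)
        change _ = k • ((1 : ℚ_[ℓ]) ⊗ₜ[ℤ_[ℓ]] (θ m))
        rw [TensorProduct.smul_tmul', smul_eq_mul, mul_one])
    φ (Θ.restrict (cc_mem_range_restrict Θ))
    (by
      intro x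
      apply Subtype.ext
      exact (hΘt 1 (x : M)).symm) hinj
  obtain ⟨f1, f2, f3⟩ := hA
  have c1 : Nat.card ↥(LinearMap.ker θ ⊓ N) = Nat.card (LinearMap.ker φ) := by
    refine Nat.card_congr ⟨fun x => ⟨⟨x.1, x.2.2⟩, Subtype.ext x.2.1⟩,
      fun y => ⟨y.1.1, congrArg Subtype.val y.2, y.1.2⟩, fun _ => rfl, fun _ => rfl⟩
  have c2 : Nat.card (M ⧸ (LinearMap.ker θ ⊔ N)) = Nat.card (N ⧸ LinearMap.range φ) := by
    have : (LinearMap.ker θ ⊔ N) = Submodule.comap θ.rangeRestrict (LinearMap.range φ) := by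
      ext x
      rw [Submodule.mem_sup, Submodule.mem_comap]
      constructor
      · rintro ⟨y, hy, z, hz, rfl⟩
        refine ⟨⟨z, hz⟩, Subtype.ext ?_⟩
        change θ z = θ (y + z)
        rw [map_add, LinearMap.mem_ker.1 hy, zero_add]
      · rintro ⟨⟨z, hz⟩, h⟩
        have h' : θ z = θ x := congrArg Subtype.val h
        exact ⟨x - z, by rw [LinearMap.mem_ker, map_sub, h', sub_self], z, hz, by abel⟩
    rw [this, ← cc_index_eq, ← cc_index_eq]
    exact AddSubgroup.index_comap_of_surjective (LinearMap.range φ).toAddSubgroup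
      (f := θ.rangeRestrict.toAddMonoidHom) θ.surjective_rangeRestrict
  rw [c1, c2]
  exact ⟨Nat.card_pos.ne', Nat.card_pos.ne', f3⟩

theorem cc_lemmaC {R H₀ H₁ E₀ E₁ E₂ : Type*} [Ring R] [AddCommGroup H₀] [Module R H₀]
    [AddCommGroup H₁] [Module R H₁] [AddCommGroup E₀] [Module R E₀] [AddCommGroup E₁] [Module R E₁]
    [AddCommGroup E₂] [Module R E₂] (π₀ : E₀ →ₗ[R] H₀) (ι₀ : H₀ →ₗ[R] E₁) (π₁ : E₁ →ₗ[R] H₁)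
    (ι₁ : H₁ →ₗ[R] E₂) (θ₀ : H₀ →ₗ[R] H₀) (θ₁ : H₁ →ₗ[R] H₁)
    (d₀ : E₀ →ₗ[R] E₁) (d₁ : E₁ →ₗ[R] E₂)
    (hd₀ : d₀ = ι₀ ∘ₗ π₀) (hd₁ : d₁ = ι₁ ∘ₗ π₁)
    (hex : LinearMap.range ι₀ = LinearMap.ker π₁)
    (hι₀ : LinearMap.ker ι₀ = LinearMap.range θ₀) (hι₁ : LinearMap.ker ι₁ = LinearMap.range θ₁)
    (hπ₀ : LinearMap.range π₀ = LinearMap.ker θ₀) (hπ₁ : LinearMap.range π₁ = LinearMap.ker θ₁) :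
    Nat.card (↥(LinearMap.ker d₁) ⧸
        Submodule.comap (LinearMap.ker d₁).subtype (LinearMap.range d₀)) =
      Nat.card (H₀ ⧸ (LinearMap.ker θ₀ ⊔ LinearMap.range θ₀)) *
        Nat.card ↥(LinearMap.ker θ₁ ⊓ LinearMap.range θ₁) := by
  have h0 : Nat.card (↥(LinearMap.ker d₁) ⧸
        Submodule.comap (LinearMap.ker d₁).subtype (LinearMap.range d₀)) =
      (LinearMap.range d₀).toAddSubgroup.relIndex (LinearMap.ker d₁).toAddSubgroup := rfl
  have l1 : LinearMap.range d₀ ≤ LinearMap.range ι₀ := by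
    rw [hd₀]; exact LinearMap.range_comp_le_range _ _
  have l2 : LinearMap.range ι₀ ≤ LinearMap.ker d₁ := by
    rw [hex, hd₁]; exact LinearMap.ker_le_ker_comp _ _
  have h1 : (LinearMap.range d₀).toAddSubgroup.relIndex (LinearMap.range ι₀).toAddSubgroup *
      (LinearMap.range ι₀).toAddSubgroup.relIndex (LinearMap.ker d₁).toAddSubgroup =
      (LinearMap.range d₀).toAddSubgroup.relIndex (LinearMap.ker d₁).toAddSubgroup :=
    AddSubgroup.relIndex_mul_relIndex _ _ _ l1 l2
  rw [h0, ← h1]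
  congr 1
  · have h2 : LinearMap.ker θ₀ ⊔ LinearMap.range θ₀ = Submodule.comap ι₀ (LinearMap.range d₀) := by
      rw [hd₀, LinearMap.range_comp, Submodule.comap_map_eq, hπ₀, hι₀]
    rw [← cc_index_eq, h2]
    exact (AddSubgroup.index_comap (LinearMap.range d₀).toAddSubgroup ι₀.toAddMonoidHom).symm
  · have h3 : LinearMap.ker θ₁ ⊓ LinearMap.range θ₁ = Submodule.map π₁ (LinearMap.ker d₁) := by
      rw [hd₁, LinearMap.ker_comp, Submodule.map_comap_eq, hπ₁, hι₁]
    rw [h3, hex]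
    exact AddSubgroup.relIndex_ker (f := π₁.toAddMonoidHom) (LinearMap.ker d₁).toAddSubgroup

section cone
variable {R V : Type*} [CommRing R] [AddCommGroup V] [Module R V]
    (X : ℤ → Submodule R V) (D T : V →ₗ[R] V)
    (CX : ℤ → Submodule R (V × V)) (DC : V × V →ₗ[R] V × V)

theorem cc_mk_eq_zero (X : ℤ → Submodule R V) (D : V →ₗ[R] V) (j : ℤ) (x : ↥(X j ⊓ LinearMap.ker D)) :
    (Submodule.Quotient.mk x : gradedCoh X D j) = 0 ↔ ∃ y ∈ X (j - 1), D y = x := by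
  rw [Submodule.Quotient.mk_eq_zero, Submodule.mem_comap]
  rfl

theorem cc_mk_eq (X : ℤ → Submodule R V) (D : V →ₗ[R] V) (j : ℤ) (x x' : ↥(X j ⊓ LinearMap.ker D)) :
    (Submodule.Quotient.mk x : gradedCoh X D j) = Submodule.Quotient.mk x' ↔
      ∃ y ∈ X (j - 1), D y = (x : V) - x' := by
  rw [Submodule.Quotient.eq, Submodule.mem_comap]
  rfl

theorem cc_iota
    (hTX : ∀ i, ∀ x ∈ X i, T x ∈ X i) (hTD : ∀ x, T (D x) = D (T x))
    (hCX : ∀ n z, z ∈ CX n ↔ z.1 ∈ X (n + 1) ∧ z.2 ∈ X n)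
    (hDC : ∀ z, DC z = (- D z.1, T z.1 + D z.2))
    (i n : ℤ) (hin : n = i) (θ : gradedCoh X D i →ₗ[R] gradedCoh X D i)
    (hθ : ∀ (x y : ↥(X i ⊓ LinearMap.ker D)), (y : V) = T (x : V) →
      θ (Submodule.Quotient.mk x) = Submodule.Quotient.mk y) :
    ∃ ι : gradedCoh X D i →ₗ[R] gradedCoh CX DC n,
      (∀ (x : ↥(X i ⊓ LinearMap.ker D)) (w : ↥(CX n ⊓ LinearMap.ker DC)), (w : V × V) = (0, (x : V)) →
        ι (Submodule.Quotient.mk x) = Submodule.Quotient.mk w) ∧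
      LinearMap.ker ι = LinearMap.range θ := by
  subst hin
  have h1 : ∀ x ∈ X n ⊓ LinearMap.ker D, LinearMap.inr R V V x ∈ CX n ⊓ LinearMap.ker DC := by
    rintro x ⟨hx, hxD⟩
    refine ⟨(hCX n _).2 ⟨Submodule.zero_mem _, hx⟩, ?_⟩
    change DC _ = 0
    rw [hDC]
    simp [LinearMap.mem_ker.1 hxD]
  have hs : n - 1 + 1 = n := by ring
  let f := (LinearMap.inr R V V).restrict h1
  have h2 : Submodule.comap (X n ⊓ LinearMap.ker D).subtype (Submodule.map D (X (n - 1))) ≤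
      Submodule.comap f (Submodule.comap (CX n ⊓ LinearMap.ker DC).subtype (Submodule.map DC (CX (n - 1)))) := by
    rintro ⟨x, hx⟩ ⟨y, hy, hyx⟩
    refine ⟨(0, y), (hCX _ _).2 ⟨Submodule.zero_mem _, hy⟩, ?_⟩
    rw [hDC]
    change (- D 0, T 0 + D y) = (0, x)
    rw [hyx]; simp
  refine ⟨Submodule.mapQ _ _ f h2, ?_, ?_⟩
  · intro x w hw
    have : w = f x := Subtype.ext hw
    rw [this]; rfl
  · ext q
    obtain ⟨⟨y, hy⟩, rfl⟩ := Submodule.Quotient.mk_surjective _ q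
    rw [LinearMap.mem_ker]
    have hmk : (Submodule.mapQ _ _ f h2) (Submodule.Quotient.mk ⟨y, hy⟩) =
      (Submodule.Quotient.mk (f ⟨y, hy⟩) : gradedCoh CX DC n) := rfl
    rw [hmk, cc_mk_eq_zero]
    constructor
    · rintro ⟨⟨x', y'⟩, hm, he⟩
      rw [hCX, hs] at hm
      rw [hDC] at he
      have e1 : - D x' = 0 := congrArg Prod.fst he
      have e2 : T x' + D y' = y := congrArg Prod.snd he
      have e1' : D x' = 0 := neg_eq_zero.1 e1
      refine ⟨Submodule.Quotient.mk ⟨x', hm.1, e1'⟩, ?_⟩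
      rw [hθ ⟨x', hm.1, e1'⟩ ⟨T x', hTX _ _ hm.1, by change D _ = 0; rw [← hTD, e1', map_zero]⟩ rfl,
        cc_mk_eq]
      refine ⟨- y', Submodule.neg_mem _ hm.2, ?_⟩
      change D (- y') = T x' - y
      rw [← e2, map_neg]; abel
    · rintro ⟨q', hq'⟩
      obtain ⟨⟨x', hx'⟩, rfl⟩ := Submodule.Quotient.mk_surjective _ q'
      have hD' : D x' = 0 := hx'.2
      rw [hθ ⟨x', hx'⟩ ⟨T x', hTX _ _ hx'.1, by change D _ = 0; rw [← hTD, hD', map_zero]⟩ rfl,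
        cc_mk_eq] at hq'
      obtain ⟨y', hy', he⟩ := hq'
      change D y' = T x' - y at he
      refine ⟨(x', - y'), (hCX _ _).2 ⟨by rw [hs]; exact hx'.1, Submodule.neg_mem _ hy'⟩, ?_⟩
      rw [hDC]
      change (- D x', T x' + D (- y')) = (0, y)
      rw [hD', map_neg, he]; simp

theorem cc_pi
    (hTX : ∀ i, ∀ x ∈ X i, T x ∈ X i) (hTD : ∀ x, T (D x) = D (T x))
    (hCX : ∀ n z, z ∈ CX n ↔ z.1 ∈ X (n + 1) ∧ z.2 ∈ X n)
    (hDC : ∀ z, DC z = (- D z.1, T z.1 + D z.2))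
    (i n : ℤ) (hin : i = n + 1) (θ : gradedCoh X D i →ₗ[R] gradedCoh X D i)
    (hθ : ∀ (x y : ↥(X i ⊓ LinearMap.ker D)), (y : V) = T (x : V) →
      θ (Submodule.Quotient.mk x) = Submodule.Quotient.mk y) :
    ∃ π : gradedCoh CX DC n →ₗ[R] gradedCoh X D i,
      (∀ (w : ↥(CX n ⊓ LinearMap.ker DC)) (x : ↥(X i ⊓ LinearMap.ker D)), (x : V) = (w : V × V).1 →
        π (Submodule.Quotient.mk w) = Submodule.Quotient.mk x) ∧
      LinearMap.range π = LinearMap.ker θ := by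
  subst hin
  have h1 : ∀ z ∈ CX n ⊓ LinearMap.ker DC, LinearMap.fst R V V z ∈ X (n + 1) ⊓ LinearMap.ker D := by
    rintro ⟨x, y⟩ ⟨hx, hxD⟩
    have hx := (hCX n _).1 hx
    change DC _ = 0 at hxD
    rw [hDC] at hxD
    exact ⟨hx.1, neg_eq_zero.1 (congrArg Prod.fst hxD)⟩
  have hs : n + 1 - 1 = n := by ring
  have hs' : n - 1 + 1 = n := by ring
  let f := (LinearMap.fst R V V).restrict h1
  have h2 : Submodule.comap (CX n ⊓ LinearMap.ker DC).subtype (Submodule.map DC (CX (n - 1))) ≤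
      Submodule.comap f (Submodule.comap (X (n + 1) ⊓ LinearMap.ker D).subtype (Submodule.map D (X (n + 1 - 1)))) := by
    rintro ⟨⟨x, y⟩, hx⟩ ⟨⟨x', y'⟩, hy, hyx⟩
    have hy := (hCX _ _).1 hy
    rw [hDC] at hyx
    rw [hs'] at hy
    refine ⟨- x', ?_, ?_⟩
    · rw [hs]; exact Submodule.neg_mem _ hy.1
    · rw [map_neg]; exact congrArg Prod.fst hyx
  refine ⟨Submodule.mapQ _ _ f h2, ?_, ?_⟩
  · intro w x hw
    have : x = f w := Subtype.ext hw
    rw [this]; rfl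
  · ext q
    obtain ⟨⟨x, hx⟩, rfl⟩ := Submodule.Quotient.mk_surjective _ q
    have hDx : D x = 0 := hx.2
    rw [LinearMap.mem_ker, hθ ⟨x, hx⟩ ⟨T x, hTX _ _ hx.1, by change D _ = 0; rw [← hTD, hDx, map_zero]⟩ rfl,
      cc_mk_eq_zero]
    constructor
    · rintro ⟨q', hq'⟩
      obtain ⟨⟨⟨x', y'⟩, hx'⟩, rfl⟩ := Submodule.Quotient.mk_surjective _ q'
      have hmk : (Submodule.mapQ _ _ f h2) (Submodule.Quotient.mk ⟨(x', y'), hx'⟩) =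
        (Submodule.Quotient.mk (f ⟨(x', y'), hx'⟩) : gradedCoh X D (n + 1)) := rfl
      rw [hmk, cc_mk_eq] at hq'
      obtain ⟨u, hu, he⟩ := hq'
      change D u = x' - x at he
      obtain ⟨hm, hk⟩ := hx'
      replace hm := (hCX _ _).1 hm
      change DC _ = 0 at hk
      rw [hDC] at hk
      have e2 : T x' + D y' = 0 := congrArg Prod.snd hk
      rw [hs] at hu ⊢
      refine ⟨- y' - T u, Submodule.sub_mem _ (Submodule.neg_mem _ hm.2) (hTX _ _ hu), ?_⟩
      change D (- y' - T u) = T x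
      rw [map_sub, map_neg, ← hTD, he, map_sub, neg_eq_of_add_eq_zero_left e2]; abel
    · rintro ⟨y, hy, he⟩
      change D y = T x at he
      rw [hs] at hy
      refine ⟨Submodule.Quotient.mk ⟨(x, - y), (hCX _ _).2 ⟨hx.1, Submodule.neg_mem _ hy⟩, ?_⟩, rfl⟩
      change DC _ = 0
      rw [hDC]
      change (- D x, T x + D (- y)) = (0, 0)
      rw [hDx, map_neg, he]; simp

theorem cc_exact
    (hTX : ∀ i, ∀ x ∈ X i, T x ∈ X i) (hTD : ∀ x, T (D x) = D (T x))
    (hCX : ∀ n z, z ∈ CX n ↔ z.1 ∈ X (n + 1) ∧ z.2 ∈ X n)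
    (hDC : ∀ z, DC z = (- D z.1, T z.1 + D z.2))
    (i j n : ℤ) (hi : n = i) (hj : j = n + 1)
    (ι : gradedCoh X D i →ₗ[R] gradedCoh CX DC n) (π : gradedCoh CX DC n →ₗ[R] gradedCoh X D j)
    (hι : ∀ (x : ↥(X i ⊓ LinearMap.ker D)) (w : ↥(CX n ⊓ LinearMap.ker DC)), (w : V × V) = (0, (x : V)) →
        ι (Submodule.Quotient.mk x) = Submodule.Quotient.mk w)
    (hπ : ∀ (w : ↥(CX n ⊓ LinearMap.ker DC)) (x : ↥(X j ⊓ LinearMap.ker D)), (x : V) = (w : V × V).1 →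
        π (Submodule.Quotient.mk w) = Submodule.Quotient.mk x) :
    LinearMap.range ι = LinearMap.ker π := by
  subst hi hj
  have hs : n + 1 - 1 = n := by ring
  have hs' : n - 1 + 1 = n := by ring
  ext q
  obtain ⟨⟨⟨x, y⟩, hm, hk⟩, rfl⟩ := Submodule.Quotient.mk_surjective _ q
  have hm' := (hCX _ _).1 hm
  have hk' := LinearMap.mem_ker.1 hk
  rw [hDC] at hk'
  have e1 : D x = 0 := neg_eq_zero.1 (congrArg Prod.fst hk')
  have e2 : T x + D y = 0 := congrArg Prod.snd hk'
  rw [LinearMap.mem_ker, hπ ⟨(x, y), hm, hk⟩ ⟨x, hm'.1, e1⟩ rfl, cc_mk_eq_zero, hs]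
  have hmem : ∀ z (_ : z ∈ X n) (_ : D z = 0), ((0 : V), z) ∈ CX n ⊓ LinearMap.ker DC := by
    intro z hz hDz
    refine ⟨(hCX _ _).2 ⟨Submodule.zero_mem _, hz⟩, ?_⟩
    change DC _ = 0
    rw [hDC]
    simp [hDz]
  constructor
  · rintro ⟨q', hq'⟩
    obtain ⟨⟨z, hz⟩, rfl⟩ := Submodule.Quotient.mk_surjective _ q'
    rw [hι ⟨z, hz⟩ ⟨(0, z), hmem z hz.1 hz.2⟩ rfl, cc_mk_eq] at hq'
    obtain ⟨⟨x', y'⟩, hu, he⟩ := hq'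
    rw [hCX, hs'] at hu
    rw [hDC] at he
    have e3 : - D x' = 0 - x := congrArg Prod.fst he
    exact ⟨x', hu.1, by simpa using e3⟩
  · rintro ⟨x', hx', he⟩
    change D x' = x at he
    have hz : D (y + T x') = 0 := by rw [map_add, ← hTD, he, add_comm, e2]
    have hzm : y + T x' ∈ X n := Submodule.add_mem _ hm'.2 (hTX _ _ hx')
    refine ⟨Submodule.Quotient.mk ⟨y + T x', hzm, hz⟩, ?_⟩
    rw [hι ⟨y + T x', hzm, hz⟩ ⟨(0, y + T x'), hmem _ hzm hz⟩ rfl, cc_mk_eq]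
    refine ⟨(x', 0), (hCX _ _).2 ⟨by rw [hs']; exact hx', Submodule.zero_mem _⟩, ?_⟩
    rw [hDC]
    change (- D x', T x' + D 0) = (0 - x, y + T x' - y)
    rw [he]; simp

end cone

theorem cc_finprod (ℓ : ℕ) [Fact ℓ.Prime] (kf cf h : ℤ → ℕ) (f : ℤ → ℚ_[ℓ])
    (hh : ∀ m, h m = cf (m - 1) * kf m) (hcf : ∀ m, cf m ≠ 0)
    (hk : ∀ m, (kf m : ℝ) = cf m * ‖f m‖) (n₀ : ℕ)
    (hb : ∀ j : ℤ, (n₀ : ℤ) < |j| → cf j = 1 ∧ kf j = 1 ∧ f j = 1) :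
    (∏ᶠ m : ℤ, ((h m : ℝ) ^ ((m.negOnePow : ℤ)))) =
      ‖∏ᶠ j : ℤ, (f j) ^ (((j + 1).negOnePow : ℤ))‖⁻¹ := by
  have fin : ∀ {G : Type} [Monoid G] (g : ℤ → G), (∀ j : ℤ, (n₀ : ℤ) < |j| → g j = 1) →
      (Function.mulSupport g).Finite := by
    intro G _ g hg
    refine (Set.finite_Icc (-(n₀ : ℤ)) n₀).subset ?_
    intro j hj
    by_contra hc
    apply hj
    apply hg
    by_contra h2
    exact hc (abs_le.1 (not_lt.1 h2))
  have s1 : (Function.mulSupport fun m : ℤ => (cf m : ℝ) ^ ((m + 1).negOnePow : ℤ)).Finite :=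
    fin _ fun j hj => by simp [(hb j hj).1]
  have s2 : (Function.mulSupport fun m : ℤ => (kf m : ℝ) ^ (m.negOnePow : ℤ)).Finite :=
    fin _ fun j hj => by simp [(hb j hj).2.1]
  have s3 : (Function.mulSupport fun m : ℤ => (f m) ^ ((m + 1).negOnePow : ℤ)).Finite :=
    fin _ fun j hj => by simp [(hb j hj).2.2]
  have e1 : ∏ᶠ m : ℤ, (cf (m - 1) : ℝ) ^ (m.negOnePow : ℤ) =
      ∏ᶠ m : ℤ, (cf m : ℝ) ^ ((m + 1).negOnePow : ℤ) := by
    have := finprod_comp_equiv (Equiv.subRight (1 : ℤ))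
      (f := fun m : ℤ => (cf m : ℝ) ^ ((m + 1).negOnePow : ℤ))
    simpa using this
  have s1' : (Function.mulSupport fun m : ℤ => (cf (m - 1) : ℝ) ^ (m.negOnePow : ℤ)).Finite := by
    have := s1.preimage ((Equiv.subRight (1 : ℤ)).injective.injOn)
    refine this.subset ?_
    intro m hm
    simpa using hm
  have e2 : ∏ᶠ m : ℤ, ((h m : ℝ) ^ ((m.negOnePow : ℤ))) =
      ∏ᶠ m : ℤ, ((cf m : ℝ) ^ ((m + 1).negOnePow : ℤ) * (kf m : ℝ) ^ (m.negOnePow : ℤ)) := by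
    rw [finprod_mul_distrib s1 s2, ← e1, ← finprod_mul_distrib s1' s2]
    refine finprod_congr fun m => ?_
    rw [hh, Nat.cast_mul, mul_zpow]
  have e3 : ‖∏ᶠ j : ℤ, (f j) ^ (((j + 1).negOnePow : ℤ))‖ =
      ∏ᶠ j : ℤ, ‖f j‖ ^ (((j + 1).negOnePow : ℤ)) := by
    have := MonoidHom.map_finprod (normHom : ℚ_[ℓ] →*₀ ℝ).toMonoidHom s3
    refine this.trans (finprod_congr fun m => ?_)
    change ‖(f m) ^ (((m + 1).negOnePow : ℤ))‖ = _
    exact norm_zpow _ _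
  rw [e2, e3, ← finprod_inv_distrib]
  refine finprod_congr fun m => ?_
  have hc : (cf m : ℝ) ≠ 0 := Nat.cast_ne_zero.2 (hcf m)
  rw [hk, mul_zpow, Int.negOnePow_succ, Units.val_neg, zpow_neg, zpow_neg, inv_inv, ← mul_assoc,
    inv_mul_cancel₀ (zpow_ne_zero _ hc), one_mul]

theorem cc_complex {R V : Type*} [CommRing R] [AddCommGroup V] [Module R V]
    (X : ℤ → Submodule R V) (D T : V →ₗ[R] V)
    (CX : ℤ → Submodule R (V × V)) (DC : V × V →ₗ[R] V × V)
    (hTX : ∀ i, ∀ x ∈ X i, T x ∈ X i) (hTD : ∀ x, T (D x) = D (T x))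
    (hCX : ∀ n z, z ∈ CX n ↔ z.1 ∈ X (n + 1) ∧ z.2 ∈ X n)
    (hDC : ∀ z, DC z = (- D z.1, T z.1 + D z.2))
    (θ : ∀ j : ℤ, gradedCoh X D j →ₗ[R] gradedCoh X D j)
    (hθ : ∀ (i : ℤ) (x y : ↥(X i ⊓ LinearMap.ker D)), (y : V) = T (x : V) →
      θ i (Submodule.Quotient.mk x) = Submodule.Quotient.mk y)
    (dE : ∀ i j : ℤ, gradedCoh CX DC (i - 1) →ₗ[R] gradedCoh CX DC (j - 1))
    (hd1 : ∀ i j : ℤ, j = i + 1 →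
        ∀ (z : ↥(CX (i - 1) ⊓ LinearMap.ker DC)) (w : ↥(CX (j - 1) ⊓ LinearMap.ker DC)),
          (w : V × V) = ((0 : V), (z : V × V).1) →
          dE i j (Submodule.Quotient.mk z) = Submodule.Quotient.mk w) :
    (∀ (i : ℤ) (x : gradedCoh CX DC (i - 1)),
          dE (i + 1) (i + 1 + 1) (dE i (i + 1) x) = 0) ∧
    ∀ m : ℤ, Nat.card (↥(LinearMap.ker (dE m (m + 1))) ⧸
          Submodule.comap (LinearMap.ker (dE m (m + 1))).subtype
            (LinearMap.range (dE (m - 1) m))) =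
      Nat.card (gradedCoh X D (m - 1) ⧸ (LinearMap.ker (θ (m - 1)) ⊔ LinearMap.range (θ (m - 1)))) *
        Nat.card ↥(LinearMap.ker (θ m) ⊓ LinearMap.range (θ m)) := by
  have hz1 : ∀ i (z : V × V), z ∈ CX (i - 1) ⊓ LinearMap.ker DC → z.1 ∈ X i ⊓ LinearMap.ker D := by
    rintro i z ⟨h1, h2⟩
    replace h1 := (hCX _ _).1 h1
    rw [sub_add_cancel] at h1
    change DC _ = 0 at h2
    rw [hDC] at h2
    exact ⟨h1.1, neg_eq_zero.1 (congrArg Prod.fst h2)⟩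
  have hz2 : ∀ i j (_ : j = i + 1) (x : V), x ∈ X i ⊓ LinearMap.ker D →
      ((0 : V), x) ∈ CX (j - 1) ⊓ LinearMap.ker DC := by
    rintro i j rfl x ⟨h1, h2⟩
    refine ⟨(hCX _ _).2 ⟨Submodule.zero_mem _, by rw [add_sub_cancel_right]; exact h1⟩, ?_⟩
    change DC _ = 0
    change D x = 0 at h2
    rw [hDC]
    simp [h2]
  have hd2 : ∀ i j (_ : j = i + 1) (π : gradedCoh CX DC (i - 1) →ₗ[R] gradedCoh X D i)
      (ι : gradedCoh X D i →ₗ[R] gradedCoh CX DC (j - 1))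
      (_ : ∀ (w : ↥(CX (i - 1) ⊓ LinearMap.ker DC)) (x : ↥(X i ⊓ LinearMap.ker D)),
        (x : V) = (w : V × V).1 → π (Submodule.Quotient.mk w) = Submodule.Quotient.mk x)
      (_ : ∀ (x : ↥(X i ⊓ LinearMap.ker D)) (w : ↥(CX (j - 1) ⊓ LinearMap.ker DC)),
        (w : V × V) = (0, (x : V)) → ι (Submodule.Quotient.mk x) = Submodule.Quotient.mk w),
      dE i j = ι ∘ₗ π := by
    intro i j hij π ι hπ hι
    refine LinearMap.ext fun q => ?_
    obtain ⟨⟨z, hz⟩, rfl⟩ := Submodule.Quotient.mk_surjective _ q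
    rw [LinearMap.comp_apply, hπ ⟨z, hz⟩ ⟨z.1, hz1 _ _ hz⟩ rfl,
      hι ⟨z.1, hz1 _ _ hz⟩ ⟨(0, z.1), hz2 _ _ hij _ (hz1 _ _ hz)⟩ rfl]
    exact hd1 i j hij ⟨z, hz⟩ _ rfl
  constructor
  · intro i q
    obtain ⟨⟨z, hz⟩, rfl⟩ := Submodule.Quotient.mk_surjective _ q
    rw [hd1 i _ rfl ⟨z, hz⟩ ⟨(0, z.1), hz2 _ _ rfl _ (hz1 _ _ hz)⟩ rfl,
      hd1 _ _ rfl _ 0 rfl]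
    rfl
  · intro m
    obtain ⟨ι₀, a1, a2⟩ := cc_iota X D T CX DC hTX hTD hCX hDC (m - 1) (m - 1) rfl _ (hθ _)
    obtain ⟨π₀, b1, b2⟩ := cc_pi X D T CX DC hTX hTD hCX hDC (m - 1) (m - 1 - 1) (by ring) _ (hθ _)
    obtain ⟨π₁, c1, c2⟩ := cc_pi X D T CX DC hTX hTD hCX hDC m (m - 1) (by ring) _ (hθ _)
    obtain ⟨ι₁, d1, d2⟩ := cc_iota X D T CX DC hTX hTD hCX hDC m (m + 1 - 1) (by ring) _ (hθ _)
    exact cc_lemmaC π₀ ι₀ π₁ ι₁ _ _ _ _ (hd2 _ _ (by ring) _ _ b1 a1) (hd2 _ _ rfl _ _ c1 d1)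
      (cc_exact X D T CX DC hTX hTD hCX hDC _ _ _ rfl (by ring) _ _ a1 c1) a2 d2 b2 c2

theorem cc_cfac_one {K M : Type*} [Field K] [AddCommGroup M] [Module K M] [Module.Finite K M]
    [Subsingleton M] (f : M →ₗ[K] M) (a b : K) :
    RatFunc.eval (RingHom.id K) b
          ((algebraMap (Polynomial K) (RatFunc K) (LinearMap.charpoly f).reverse) *
            (algebraMap (Polynomial K) (RatFunc K)
              (1 - Polynomial.C a * Polynomial.X)) ^
                (-(((LinearMap.charpoly f).rootMultiplicity a : ℕ) : ℤ))) = 1 := by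
  have h : LinearMap.charpoly f = 1 := by
    have h1 := LinearMap.charpoly_monic f
    have h2 := LinearMap.charpoly_natDegree f
    rw [Module.finrank_zero_of_subsingleton] at h2
    exact h1.natDegree_eq_zero.1 h2
  rw [h]
  have h3 : Polynomial.reverse (1 : Polynomial K) = 1 := by
    simpa using Polynomial.reverse_C (1 : K)
  rw [h3, Polynomial.rootMultiplicity_eq_zero (by simp)]
  simp

/-- Let `ℓ` be a prime, `q` a power of a prime `p ≠ ℓ`, `r ∈ ℤ`.
Let `X` be a bounded cochain complex of `ℤ_ℓ`-modules with finitely generated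
cohomology, `γ` an automorphism of complexes, `E^j := H^{j-1}(Cone(1 - q^{-r} γ))`, and
assume `q^r` is not a multiple root of the minimal polynomial of `γ` on any
`H^j(X) ⊗ ℚ_ℓ`.  Let `d^j : E^j → E^{j+1}` be the composite of the surjection
`E^j → Ker(1 - q^{-r}γ ∣ H^j(X))`, the map induced by the identity of `H^j(X)`, and the
injection `Coker(1 - q^{-r}γ ∣ H^j(X)) → E^{j+1}`; on representatives of the cone
cohomology it is the map `[(x, y)] ↦ [(0, x)]`.  Then `(E^•, d^•)` is a complex with
finite cohomology groups, and the alternating product `χ^×` of their orders equals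
`|∏_j (∏_{a_{j,i} ≠ q^r} (1 - a_{j,i}/q^r))^{(-1)^{j+1}}|_ℓ^{-1}`, the `a_{j,i}` being
the eigenvalues of `γ` on `H^j(X) ⊗ ℚ_ℓ`.  The Galois-stable inner eigenvalue product
is expressed as the value at `t = q^{-r}` of
`det(1 - γ t ∣ H^j(X) ⊗ ℚ_ℓ)/(1 - q^r t)^{ρ_j}`, where `det(1 - γ t)` is the reverse
characteristic polynomial and `ρ_j` the multiplicity of `q^r` as one of its inverse
roots.  The complex is presented as a graded module (`V`, `X`, `D`) and the mapping
cone lives in `V × V`, graded by `CX n = X (n+1) × X n`. -/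
theorem cone_cohomology_alternating_product
    (ℓ : ℕ) [Fact ℓ.Prime] (p k : ℕ) (hp : p.Prime) (hpℓ : p ≠ ℓ) (hk : 0 < k)
    (q : ℕ) (hq : q = p ^ k) (r : ℤ)
    (uq : ℤ_[ℓ]ˣ) (huq : (uq : ℤ_[ℓ]) = (q : ℤ_[ℓ]))
    (V : Type) [AddCommGroup V] [Module ℤ_[ℓ] V]
    (X : ℤ → Submodule ℤ_[ℓ] V)
    (n₀ : ℕ) (hbdd : ∀ j : ℤ, (n₀ : ℤ) < |j| → X j = ⊥)
    (D : V →ₗ[ℤ_[ℓ]] V) (hD : ∀ i : ℤ, ∀ x ∈ X i, D x ∈ X (i + 1))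
    (hDD : ∀ x : V, D (D x) = 0)
    (U : V ≃ₗ[ℤ_[ℓ]] V) (hUX : ∀ i : ℤ, ∀ x ∈ X i, U x ∈ X i)
    (hUX' : ∀ i : ℤ, ∀ x ∈ X i, U.symm x ∈ X i)
    (hUD : ∀ x : V, U (D x) = D (U x))
    (hfg : ∀ j : ℤ, Module.Finite ℤ_[ℓ] (gradedCoh X D j))
    (γH : ∀ j : ℤ, gradedCoh X D j →ₗ[ℤ_[ℓ]] gradedCoh X D j)
    (hγH : ∀ (j : ℤ) (x y : ↥(X j ⊓ LinearMap.ker D)), (y : V) = U (x : V) →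
      γH j (Submodule.Quotient.mk x) = Submodule.Quotient.mk y)
    (hss : ∀ j : ℤ,
      ((minpoly ℚ_[ℓ] (LinearMap.baseChange ℚ_[ℓ] (γH j))).rootMultiplicity
        ((q : ℚ_[ℓ]) ^ r)) ≤ 1) :
    letI c : ℤ_[ℓ] := ((uq ^ (-r) : ℤ_[ℓ]ˣ) : ℤ_[ℓ])
    letI CX : ℤ → Submodule ℤ_[ℓ] (V × V) := fun n => (X (n + 1)).prod (X n)
    letI DC : V × V →ₗ[ℤ_[ℓ]] V × V :=
      LinearMap.prod ((-D).comp (LinearMap.fst ℤ_[ℓ] V V))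
        (((LinearMap.id - c • (U : V →ₗ[ℤ_[ℓ]] V)).comp (LinearMap.fst ℤ_[ℓ] V V)) +
          D.comp (LinearMap.snd ℤ_[ℓ] V V))
    ∀ dE : ∀ i j : ℤ, gradedCoh CX DC (i - 1) →ₗ[ℤ_[ℓ]] gradedCoh CX DC (j - 1),
      (∀ i j : ℤ, j ≠ i + 1 → dE i j = 0) →
      (∀ i j : ℤ, j = i + 1 →
        ∀ (z : ↥(CX (i - 1) ⊓ LinearMap.ker DC)) (w : ↥(CX (j - 1) ⊓ LinearMap.ker DC)),
          (w : V × V) = ((0 : V), (z : V × V).1) →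
          dE i j (Submodule.Quotient.mk z) = Submodule.Quotient.mk w) →
      letI HE : ℤ → Type _ := fun m =>
        ↥(LinearMap.ker (dE m (m + 1))) ⧸
          Submodule.comap (LinearMap.ker (dE m (m + 1))).subtype
            (LinearMap.range (dE (m - 1) m))
      letI hQ : ∀ j : ℤ, Module.Finite ℚ_[ℓ] (ℚ_[ℓ] ⊗[ℤ_[ℓ]] gradedCoh X D j) :=
        fun j => by haveI := hfg j; infer_instance
      letI χ : ℤ → Polynomial ℚ_[ℓ] :=
        fun j => charpolyOfFinite (hQ j) (LinearMap.baseChange ℚ_[ℓ] (γH j))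
      letI ρj : ℤ → ℕ := fun j => (χ j).rootMultiplicity ((q : ℚ_[ℓ]) ^ r)
      letI cfac : ℤ → ℚ_[ℓ] := fun j =>
        RatFunc.eval (RingHom.id ℚ_[ℓ]) ((q : ℚ_[ℓ]) ^ (-r))
          ((algebraMap (Polynomial ℚ_[ℓ]) (RatFunc ℚ_[ℓ]) (χ j).reverse) *
            (algebraMap (Polynomial ℚ_[ℓ]) (RatFunc ℚ_[ℓ])
              (1 - Polynomial.C ((q : ℚ_[ℓ]) ^ r) * Polynomial.X)) ^ (-(ρj j : ℤ)))
      ((∀ (i : ℤ) (x : gradedCoh CX DC (i - 1)),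
          dE (i + 1) (i + 1 + 1) (dE i (i + 1) x) = 0) ∧
        (∀ m : ℤ, Finite (HE m)) ∧
        (∏ᶠ m : ℤ, ((Nat.card (HE m) : ℝ) ^ ((m.negOnePow : ℤ))))
          = ‖∏ᶠ j : ℤ, (cfac j) ^ (((j + 1).negOnePow : ℤ))‖⁻¹) := by
  intro dE hd0 hd1
  have hp0 : (q : ℚ_[ℓ]) ≠ 0 := by
    rw [hq]; exact Nat.cast_ne_zero.2 (pow_ne_zero _ hp.ne_zero)
  have ha : (q : ℚ_[ℓ]) ^ r ≠ 0 := zpow_ne_zero _ hp0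
  have hqa : (q : ℚ_[ℓ]) ^ (-r) = ((q : ℚ_[ℓ]) ^ r)⁻¹ := zpow_neg _ _
  have hca : ((((uq ^ (-r) : ℤ_[ℓ]ˣ) : ℤ_[ℓ])) : ℚ_[ℓ]) = ((q : ℚ_[ℓ]) ^ r)⁻¹ := by
    rw [← hqa]
    have h1 : ((Units.map (PadicInt.Coe.ringHom (p := ℓ)).toMonoidHom (uq ^ (-r)) : ℚ_[ℓ]ˣ) : ℚ_[ℓ]) =
      (q : ℚ_[ℓ]) ^ (-r) := by
      rw [map_zpow, Units.val_zpow_eq_zpow_val]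
      congr 1
      change ((uq : ℤ_[ℓ]) : ℚ_[ℓ]) = q
      rw [huq]; simp
    exact h1
  generalize ((uq ^ (-r) : ℤ_[ℓ]ˣ) : ℤ_[ℓ]) = c at *
  have hTX : ∀ i, ∀ x ∈ X i, (LinearMap.id - c • (U : V →ₗ[ℤ_[ℓ]] V) : V →ₗ[ℤ_[ℓ]] V) x ∈ X i := fun i x hx =>
    Submodule.sub_mem _ hx (Submodule.smul_mem _ _ (hUX _ _ hx))
  have hTD : ∀ x, (LinearMap.id - c • (U : V →ₗ[ℤ_[ℓ]] V) : V →ₗ[ℤ_[ℓ]] V) (D x) =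
      D ((LinearMap.id - c • (U : V →ₗ[ℤ_[ℓ]] V) : V →ₗ[ℤ_[ℓ]] V) x) := fun x => by simp [hUD]
  obtain ⟨θ, hθx⟩ : ∃ θ : ∀ j : ℤ, gradedCoh X D j →ₗ[ℤ_[ℓ]] gradedCoh X D j,
      ∀ j x, θ j x = x - c • γH j x :=
    ⟨fun j => LinearMap.id - c • γH j, fun j x => rfl⟩
  have hθ : ∀ (i : ℤ) (x y : ↥(X i ⊓ LinearMap.ker D)),
      (y : V) = (LinearMap.id - c • (U : V →ₗ[ℤ_[ℓ]] V) : V →ₗ[ℤ_[ℓ]] V) (x : V) →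
      θ i (Submodule.Quotient.mk x) = Submodule.Quotient.mk y := by
    intro i x y hy
    have hm : U x ∈ X i ⊓ LinearMap.ker D := by
      refine ⟨hUX _ _ x.2.1, ?_⟩
      change D _ = 0
      rw [← hUD]
      have : D x = 0 := x.2.2
      rw [this, map_zero]
    have hy' : y = x - c • ⟨U x, hm⟩ := Subtype.ext hy
    rw [hθx, hγH i x ⟨U x, hm⟩ rfl, hy']
    rfl
  obtain ⟨hdd, hcard⟩ := cc_complex X D (LinearMap.id - c • (U : V →ₗ[ℤ_[ℓ]] V) : V →ₗ[ℤ_[ℓ]] V) _ _ hTX hTD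
    (fun n z => Submodule.mem_prod) (fun z => rfl) θ hθ dE hd1
  haveI hfg' := hfg
  have htate := fun j =>
    cc_tate ℓ (γH j) (θ j) _ ha c hca (hθx j) (hss j)
  refine ⟨hdd, fun m => ?_, ?_⟩
  · refine Nat.finite_of_card_ne_zero ?_
    rw [hcard]
    exact mul_ne_zero (htate _).2.1 (htate _).1
  · refine cc_finprod ℓ (fun m => Nat.card ↥(LinearMap.ker (θ m) ⊓
        LinearMap.range (θ m)))
      (fun m => Nat.card (gradedCoh X D m ⧸ (LinearMap.ker (θ m) ⊔
        LinearMap.range (θ m)))) _ _ hcard (fun m => (htate m).2.1) ?_ n₀ ?_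
    · intro m
      have h3 := (htate m).2.2
      rw [← hqa] at h3
      exact h3
    · intro j hj
      have hX := hbdd j hj
      haveI hS : Subsingleton (gradedCoh X D j) := by
        have h1 : ∀ x : ↥(X j ⊓ LinearMap.ker D), x = 0 := by
          rintro ⟨x, hx⟩
          have : x ∈ X j := hx.1
          rw [hX] at this
          exact Subtype.ext ((Submodule.mem_bot _).1 this)
        refine subsingleton_of_forall_eq 0 fun y => ?_
        obtain ⟨x, rfl⟩ := Submodule.Quotient.mk_surjective _ y
        rw [h1 x]; rfl
      haveI := hfg j
      haveI : Subsingleton (ℚ_[ℓ] ⊗[ℤ_[ℓ]] gradedCoh X D j) := inferInstance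
      refine ⟨?_, ?_, ?_⟩
      · exact Nat.card_of_subsingleton 0
      · exact Nat.card_of_subsingleton 0
      · exact cc_cfac_one (LinearMap.baseChange ℚ_[ℓ] (γH j)) _ _
end

section
/- Let ℓ be a prime and Γ a group. Let V and V' be finite-dimensional ℚ_ℓ-vector spaces with ℚ_ℓ-linear Γ-actions such that V and V' are isomorphic as Γ-representations, and let ⟨ , ⟩ : V × V' → ℚ_ℓ be a nondegenerate ℚ_ℓ-bilinear pairing satisfying ⟨σv, σv'⟩ = ⟨v, v'⟩ for all σ ∈ Γ. Let A ⊆ V^Γ and A' ⊆ (V')^Γ be ℚ-subspaces with ⟨a, a'⟩ ∈ ℚ for all a ∈ A, a' ∈ A'; set N = {a ∈ A : ⟨a, a'⟩ = 0 for all a' ∈ A'} and N' = {a' ∈ A' : ⟨a, a'⟩ = 0 for all a ∈ A}. Consider the conditions: T: the ℚ_ℓ-span of A equals V^Γ; T': the ℚ_ℓ-span of A' equals (V')^Γ; I: the natural map ℚ_ℓ ⊗_ℚ A → V is injective; I': the natural map ℚ_ℓ ⊗_ℚ A' → V' is injective; E: N = 0; E': N' = 0; S: the map V^Γ → V_Γ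 induced by the identity of V is bijective; S': the map (V')^Γ → (V')_Γ induced by the identity of V' is bijective. Then the following are equivalent: (a) A/N is a finite-dimensional ℚ-vector space with dim_ℚ(A/N) = dim_{ℚ_ℓ}(V^Γ); (b) T and E hold; (c) T, T', and S hold; (d) T, T', E, E', I, I', S, and S' all hold. -/
theorem aux_li {K : Type*} [Field K] [CharZero K] {ι κ : Type*} [Fintype κ] [Finite ι]
    (v : ι → κ → ℚ) (h : LinearIndependent ℚ v) :
    LinearIndependent K (fun i (j : κ) => ((v i j : ℚ) : K)) := by
  classical
  have := Fintype.ofFinite ι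
  obtain ⟨g, hg⟩ := (Fintype.linearCombination ℚ v).exists_leftInverse_of_injective (by
    exact LinearMap.ker_eq_bot.2 h.fintypeLinearCombination_injective)
  have hgv : ∀ i, g (v i) = Pi.single i 1 := by
    intro i
    have := LinearMap.congr_fun hg (Pi.single i 1)
    simpa [Fintype.linearCombination_apply_single] using this
  rw [Fintype.linearIndependent_iff]
  intro c hc i
  have hj : ∀ j, ∑ k, c k * ((v k j : ℚ) : K) = 0 := by
    intro j
    have := congrFun hc j
    simpa using this
  have hd : ∀ k, ∑ j, v k j * g (Pi.single j 1) i = if i = k then 1 else 0 := by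
    intro k
    have h1 := congrFun (hgv k) i
    rw [LinearMap.pi_apply_eq_sum_univ g (v k)] at h1
    simp only [Finset.sum_apply, Pi.smul_apply, smul_eq_mul, Pi.single_apply] at h1
    rw [← h1]
    refine Finset.sum_congr rfl fun j _ => ?_
    have hs : (Pi.single j 1 : κ → ℚ) = fun l => if j = l then 1 else 0 := by
      ext l
      simp [Pi.single_apply, eq_comm]
    rw [hs]
  have : ∑ j, (∑ k, c k * ((v k j : ℚ) : K)) * ((g (Pi.single j 1) i : ℚ) : K) = 0 := by
    simp [hj]
  simp_rw [Finset.sum_mul] at this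
  rw [Finset.sum_comm] at this
  have h2 : ∀ k, ∑ j, c k * ((v k j : ℚ) : K) * ((g (Pi.single j 1) i : ℚ) : K)
      = if i = k then c k else 0 := by
    intro k
    have := congrArg (fun q : ℚ => (q : K)) (hd k)
    push_cast at this
    simp_rw [mul_assoc]
    rw [← Finset.mul_sum, this]
    split_ifs <;> simp
  simp_rw [h2] at this
  simpa using this

theorem aux_rank {K : Type*} [Field K] [CharZero K] {κ : Type*} [Fintype κ]
    (P : Submodule ℚ (κ → ℚ)) :
    Module.finrank K (Submodule.span K
      ((fun (f : κ → ℚ) (j : κ) => ((f j : ℚ) : K)) '' (P : Set (κ → ℚ)))) =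
      Module.finrank ℚ P := by
  classical
  let b := Module.finBasis ℚ P
  have hb : LinearIndependent ℚ (fun i => (b i : κ → ℚ)) :=
    b.linearIndependent.map' P.subtype P.ker_subtype
  have h1 := aux_li (K := K) _ hb
  have h2 := finrank_span_eq_card h1
  rw [Fintype.card_fin] at h2
  rw [← h2]
  refine congrArg (fun X : Submodule K (κ → K) => Module.finrank K X) ?_
  apply le_antisymm
  · rw [Submodule.span_le]
    rintro _ ⟨f, hf, rfl⟩
    have h3 := congrArg (Subtype.val) (b.sum_repr ⟨f, hf⟩)
    have h4 : (fun j => ((f j : ℚ) : K)) =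
      ∑ i, ((b.repr ⟨f, hf⟩ i : ℚ) : K) • (fun j => (((b i : κ → ℚ) j : ℚ) : K)) := by
      ext j
      have := congrFun h3 j
      simp only [Submodule.coe_sum, Submodule.coe_smul, Finset.sum_apply, Pi.smul_apply,
        smul_eq_mul] at this
      rw [← this]
      simp
    simp only [SetLike.mem_coe]
    rw [h4]
    exact Submodule.sum_mem _ fun i _ => Submodule.smul_mem _ _ (Submodule.subset_span ⟨i, rfl⟩)
  · apply Submodule.span_mono
    rintro _ ⟨i, rfl⟩
    exact ⟨_, (b i).2, rfl⟩

theorem aux_key {K V V' : Type*} [Field K] [CharZero K] [AddCommGroup V] [AddCommGroup V']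
    [Module K V] [Module K V'] [FiniteDimensional K V] [FiniteDimensional K V']
    [Module ℚ V] [Module ℚ V']
    (φ : V →ₗ[K] V' →ₗ[K] K) (A : Submodule ℚ V) (A' : Submodule ℚ V')
    (hr : ∀ a ∈ A, ∀ a' ∈ A', ∃ r : ℚ, φ a a' = (r : K)) (N : Submodule ℚ V)
    (hN : ∀ x : V, x ∈ N ↔ x ∈ A ∧ ∀ a' ∈ A', φ x a' = 0) :
    ∃ (r : ℕ) (Ψ : V →ₗ[K] (Fin r → K)), r = Module.finrank K (Submodule.span K (A' : Set V')) ∧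
      (∀ v, Ψ v = 0 ↔ ∀ v' ∈ Submodule.span K (A' : Set V'), φ v v' = 0) ∧
      FiniteDimensional ℚ (A ⧸ N.comap A.subtype) ∧
      Module.finrank ℚ (A ⧸ N.comap A.subtype) =
        Module.finrank K ((Submodule.span K (A : Set V)).map Ψ) ∧
      (N = ⊥ → ∀ (n : ℕ) (a : Fin n → V), (∀ i, a i ∈ A) → LinearIndependent ℚ a →
        LinearIndependent K a) := by
  classical
  obtain ⟨t, ht, hspan, hli⟩ := exists_linearIndependent K (A' : Set V')
  have hfin : Finite t := hli.finite
  have := Fintype.ofFinite t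
  have hcard : Fintype.card t = Module.finrank K (Submodule.span K (A' : Set V')) := by
    rw [← hspan]
    have := finrank_span_eq_card hli
    rw [Subtype.range_coe] at this
    exact this.symm
  let e := (Fintype.equivFin t).symm
  let b : Fin (Fintype.card t) → V' := fun i => (e i : V')
  have hbA : ∀ i, b i ∈ A' := fun i => ht (e i).2
  have hbs : Submodule.span K (Set.range b) = Submodule.span K (A' : Set V') := by
    rw [← hspan]
    congr 1
    ext x
    constructor
    · rintro ⟨i, rfl⟩
      exact (e i).2
    · intro hx
      exact ⟨e.symm ⟨x, hx⟩, by simp [b]⟩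
  let Ψ : V →ₗ[K] (Fin (Fintype.card t) → K) := LinearMap.pi fun i => φ.flip (b i)
  have hΨ : ∀ v i, Ψ v i = φ v (b i) := fun v i => rfl
  have hΨ0 : ∀ v, Ψ v = 0 ↔ ∀ v' ∈ Submodule.span K (A' : Set V'), φ v v' = 0 := by
    intro v
    constructor
    · intro h v' hv'
      rw [← hbs] at hv'
      have : Submodule.span K (Set.range b) ≤ LinearMap.ker (φ v) := by
        rw [Submodule.span_le]
        rintro _ ⟨i, rfl⟩
        exact congrFun h i
      exact this hv'
    · intro h
      ext i
      exact h _ (Submodule.subset_span (hbA i))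
  have hΨ1 : ∀ v, Ψ v = 0 ↔ ∀ v' ∈ A', φ v v' = 0 := by
    intro v
    rw [hΨ0]
    constructor
    · intro h v' hv'
      exact h v' (Submodule.subset_span hv')
    · intro h v' hv'
      have : Submodule.span K (A' : Set V') ≤ LinearMap.ker (φ v) := by
        rw [Submodule.span_le]
        exact h
      exact this hv'
  have hq : ∀ (a : A) i, ∃ r : ℚ, φ a (b i) = (r : K) := fun a i => hr a a.2 _ (hbA i)
  choose g0 hg0 using hq
  let g : A →ₗ[ℚ] (Fin (Fintype.card t) → ℚ) := AddMonoidHom.toRatLinearMap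
    { toFun := g0
      map_zero' := by
        ext i
        have := hg0 0 i
        simp only [Submodule.coe_zero, map_zero, LinearMap.zero_apply] at this
        exact_mod_cast this.symm
      map_add' := by
        intro x y
        ext i
        have := hg0 (x + y) i
        simp only [Submodule.coe_add, map_add, LinearMap.add_apply, hg0] at this
        exact_mod_cast this.symm }
  have hg : ∀ (a : A), Ψ a = fun i => ((g a i : ℚ) : K) := by
    intro a
    ext i
    exact hg0 a i
  have hker : LinearMap.ker g = N.comap A.subtype := by
    ext a
    rw [LinearMap.mem_ker, Submodule.mem_comap, hN]
    simp only [Submodule.subtype_apply, SetLike.coe_mem, true_and]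
    rw [← hΨ1, hg]
    constructor
    · intro h
      rw [h]
      ext; simp
    · intro h
      ext i
      have := congrFun h i
      simpa using this
  let q : (A ⧸ N.comap A.subtype) ≃ₗ[ℚ] LinearMap.range g :=
    (Submodule.quotEquivOfEq _ _ hker.symm).trans g.quotKerEquivRange
  refine ⟨_, Ψ, hcard, hΨ0, Module.Finite.equiv q.symm, ?_, ?_⟩
  · rw [q.finrank_eq, ← aux_rank (K := K), Submodule.map_span]
    refine congrArg (fun X : Set (Fin (Fintype.card t) → K) =>
      Module.finrank K (Submodule.span K X)) ?_
    ext x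
    constructor
    · rintro ⟨_, ⟨a, rfl⟩, rfl⟩
      exact ⟨a, a.2, hg a⟩
    · rintro ⟨a, ha, rfl⟩
      exact ⟨_, ⟨⟨a, ha⟩, rfl⟩, (hg ⟨a, ha⟩).symm⟩
  · intro hN0 n a ha hlin
    have hk : LinearMap.ker g = ⊥ := by
      rw [hker, hN0]
      exact A.ker_subtype
    have h1 : LinearIndependent ℚ (fun i => (⟨a i, ha i⟩ : A)) :=
      LinearIndependent.of_comp A.subtype hlin
    have h2 := aux_li (K := K) _ (h1.map' g hk)
    refine LinearIndependent.of_comp Ψ ?_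
    convert h2 using 1
    ext i j
    exact congrFun (hg ⟨a i, ha i⟩) j

theorem aux_S {K Γ V V' : Type*} [Field K] [Group Γ] [AddCommGroup V] [AddCommGroup V']
    [Module K V] [Module K V'] [FiniteDimensional K V] [FiniteDimensional K V']
    (ρ : Representation K Γ V) (ρ' : Representation K Γ V')
    (φ : V →ₗ[K] V' →ₗ[K] K)
    (hnd₁ : ∀ v : V, (∀ v' : V', φ v v' = 0) → v = 0)
    (hnd₂ : ∀ v' : V', (∀ v : V, φ v v' = 0) → v' = 0)
    (hinv : ∀ (σ : Γ) (v : V) (v' : V'), φ (ρ σ v) (ρ' σ v') = φ v v')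
    (W : Submodule K V) (W' : Submodule K V') (hW' : ∀ x, x ∈ W' ↔ ∀ σ, ρ' σ x = x)
    (hd : Module.finrank K W = Module.finrank K W')
    (C : Submodule K V) (hC : C = Submodule.span K {x : V | ∃ (σ : Γ) (v : V), ρ σ v - v = x}) :
    Function.Bijective (C.mkQ.comp W.subtype) ↔
      ∀ w ∈ W, (∀ w' ∈ W', φ w w' = 0) → w = 0 := by
  have hi1 : Function.Injective φ := by
    rw [← LinearMap.ker_eq_bot, LinearMap.ker_eq_bot']
    intro v hv
    exact hnd₁ v fun v' => by rw [hv]; rfl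
  have hi2 : Function.Injective φ.flip := by
    rw [← LinearMap.ker_eq_bot, LinearMap.ker_eq_bot']
    intro v hv
    exact hnd₂ v fun v' => LinearMap.congr_fun hv v'
  have e1 := LinearMap.finrank_le_finrank_of_injective hi1
  have e2 := LinearMap.finrank_le_finrank_of_injective hi2
  have d1 : Module.finrank K (V →ₗ[K] K) = Module.finrank K V := Subspace.dual_finrank_eq
  have d2 : Module.finrank K (V' →ₗ[K] K) = Module.finrank K V' := Subspace.dual_finrank_eq
  have hs2 : Function.Surjective φ.flip :=
    (LinearMap.injective_iff_surjective_of_finrank_eq_finrank (by omega)).1 hi2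
  have hmem : ∀ v', v' ∈ W' ↔ ∀ x ∈ C, φ x v' = 0 := by
    intro v'
    rw [hW']
    constructor
    · intro h x hx
      have : C ≤ LinearMap.ker (φ.flip v') := by
        rw [hC, Submodule.span_le]
        rintro _ ⟨σ, v, rfl⟩
        have := hinv σ v v'
        rw [h σ] at this
        simp [this]
      exact this hx
    · intro h σ
      rw [← sub_eq_zero]
      apply hnd₂
      intro v
      have h1 := hinv σ (ρ σ⁻¹ v) v'
      rw [ρ.self_inv_apply] at h1
      have h2 := h (ρ σ⁻¹ v - v) (by rw [hC]; exact Submodule.subset_span ⟨_, _, rfl⟩)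
      simp only [map_sub, LinearMap.sub_apply] at h2 ⊢
      rw [h1, h2]
  have hmap : W'.map φ.flip = C.dualAnnihilator := by
    ext f
    rw [Submodule.mem_map, Submodule.mem_dualAnnihilator]
    constructor
    · rintro ⟨y, hy, rfl⟩ w hw
      exact (hmem y).1 hy w hw
    · intro h
      obtain ⟨y, rfl⟩ := hs2 f
      exact ⟨y, (hmem y).2 h, rfl⟩
  have hdim : Module.finrank K W' = Module.finrank K C.dualAnnihilator := by
    rw [← hmap]; exact (Submodule.equivMapOfInjective _ hi2 W').finrank_eq
  have hdim2 := Subspace.finrank_add_finrank_dualAnnihilator_eq C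
  have hdim3 := C.finrank_quotient_add_finrank
  have hCmem : ∀ v, v ∈ C ↔ ∀ w' ∈ W', φ v w' = 0 := by
    intro v
    constructor
    · intro h w' hw'
      exact (hmem w').1 hw' v h
    · intro h
      rw [← Subspace.dualAnnihilator_dualCoannihilator_eq (W := C), Submodule.mem_dualCoannihilator,
        ← hmap]
      rintro _ ⟨w', hw', rfl⟩
      exact h w' hw'
  have hin : Function.Injective (C.mkQ.comp W.subtype) ↔
      ∀ w ∈ W, (∀ w' ∈ W', φ w w' = 0) → w = 0 := by
    rw [← LinearMap.ker_eq_bot, LinearMap.ker_eq_bot']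
    simp only [LinearMap.comp_apply, Submodule.subtype_apply, Submodule.mkQ_apply,
      Submodule.Quotient.mk_eq_zero, hCmem, Subtype.forall, Submodule.mk_eq_zero]
  rw [← hin]
  refine ⟨fun h => h.1, fun h => ⟨h, ?_⟩⟩
  exact (LinearMap.injective_iff_surjective_of_finrank_eq_finrank (by omega)).1 h

theorem aux_swap {K V V' : Type*} [Field K] [AddCommGroup V] [AddCommGroup V']
    [Module K V] [Module K V'] [FiniteDimensional K V] [FiniteDimensional K V']
    (φ : V →ₗ[K] V' →ₗ[K] K)
    (W : Submodule K V) (W' : Submodule K V')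
    (hd : Module.finrank K W = Module.finrank K W')
    (h : ∀ w ∈ W, (∀ w' ∈ W', φ w w' = 0) → w = 0) :
    ∀ w' ∈ W', (∀ w ∈ W, φ w w' = 0) → w' = 0 := by
  intro w' hw' h0
  let F : W →ₗ[K] Module.Dual K W' := (Submodule.dualRestrict W').comp (φ.comp W.subtype)
  have hF : ∀ (w : W) (x : W'), F w x = φ w x := fun _ _ => rfl
  have hi : Function.Injective F := by
    rw [← LinearMap.ker_eq_bot, LinearMap.ker_eq_bot']
    intro w hw
    apply Subtype.ext
    refine h w w.2 fun x hx => ?_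
    rw [← hF w ⟨x, hx⟩, hw]; rfl
  have hs : Function.Surjective F :=
    (LinearMap.injective_iff_surjective_of_finrank_eq_finrank
      (by rw [Subspace.dual_finrank_eq, hd])).1 hi
  have : (⟨w', hw'⟩ : W') = 0 := by
    rw [← Module.forall_dual_apply_eq_zero_iff K]
    intro f
    obtain ⟨w, rfl⟩ := hs f
    exact h0 w w.2
  simpa using this

theorem aux_main {K V V' : Type*} [Field K] [CharZero K] [AddCommGroup V] [AddCommGroup V']
    [Module K V] [Module K V'] [FiniteDimensional K V] [FiniteDimensional K V']
    [Module ℚ V] [Module ℚ V']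
    (φ : V →ₗ[K] V' →ₗ[K] K) (A : Submodule ℚ V) (A' : Submodule ℚ V')
    (hr : ∀ a ∈ A, ∀ a' ∈ A', ∃ r : ℚ, φ a a' = (r : K)) (N : Submodule ℚ V)
    (hN : ∀ x : V, x ∈ N ↔ x ∈ A ∧ ∀ a' ∈ A', φ x a' = 0)
    (W : Submodule K V) (W' : Submodule K V') (hAW : (A : Set V) ⊆ W) (hAW' : (A' : Set V') ⊆ W')
    (hd : Module.finrank K W = Module.finrank K W') :
    ((FiniteDimensional ℚ (A ⧸ N.comap A.subtype) ∧
      Module.finrank ℚ (A ⧸ N.comap A.subtype) = Module.finrank K W) ↔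
      (Submodule.span K (A : Set V) = W ∧ N = ⊥)) ∧
    ((FiniteDimensional ℚ (A ⧸ N.comap A.subtype) ∧
      Module.finrank ℚ (A ⧸ N.comap A.subtype) = Module.finrank K W) ↔
      (Submodule.span K (A : Set V) = W ∧ Submodule.span K (A' : Set V') = W' ∧
        ∀ w ∈ W, (∀ w' ∈ W', φ w w' = 0) → w = 0)) ∧
    (N = ⊥ → ∀ (n : ℕ) (a : Fin n → V), (∀ i, a i ∈ A) → LinearIndependent ℚ a →
        LinearIndependent K a) := by
  obtain ⟨r, Ψ, hrk, hΨ, hfd, hfr, hI⟩ := aux_key φ A A' hr N hN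
  have hle : Submodule.span K (A : Set V) ≤ W := Submodule.span_le.2 hAW
  have hle' : Submodule.span K (A' : Set V') ≤ W' := Submodule.span_le.2 hAW'
  set B := Submodule.span K (A : Set V) with hB
  set B' := Submodule.span K (A' : Set V') with hB'
  have m1 := Submodule.finrank_mono hle
  have m2 := Submodule.finrank_mono hle'
  have m3 := Submodule.finrank_map_le Ψ B
  have m4 := Submodule.finrank_le (B.map Ψ)
  rw [Module.finrank_fin_fun] at m4
  have inj : ∀ (hh : Module.finrank K (B.map Ψ) = Module.finrank K B), ∀ w ∈ B, Ψ w = 0 → w = 0 := by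
    intro hh w hw h0
    have hsurj : Function.Surjective (Ψ.submoduleMap B) := Ψ.submoduleMap_surjective B
    have hinj := (LinearMap.injective_iff_surjective_of_finrank_eq_finrank hh.symm).2 hsurj
    have : (⟨w, hw⟩ : B) = 0 := hinj (by
      apply Subtype.ext
      simpa using h0)
    simpa using this
  have ac : (FiniteDimensional ℚ (A ⧸ N.comap A.subtype) ∧
      Module.finrank ℚ (A ⧸ N.comap A.subtype) = Module.finrank K W) →
      (B = W ∧ B' = W' ∧ ∀ w ∈ W, (∀ w' ∈ W', φ w w' = 0) → w = 0) := by
    rintro ⟨-, h⟩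
    have h1 : B = W := Submodule.eq_of_le_of_finrank_eq hle (by omega)
    have h2 : B' = W' := Submodule.eq_of_le_of_finrank_eq hle' (by omega)
    refine ⟨h1, h2, fun w hw h0 => ?_⟩
    rw [← h1] at hw
    refine inj (by omega) w hw ?_
    rw [hΨ, h2]
    exact h0
  have cb : (B = W ∧ B' = W' ∧ ∀ w ∈ W, (∀ w' ∈ W', φ w w' = 0) → w = 0) → (B = W ∧ N = ⊥) := by
    rintro ⟨h1, h2, h3⟩
    refine ⟨h1, ?_⟩
    rw [eq_bot_iff]
    intro x hx
    have hx' := (hN x).1 hx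
    refine h3 x (hAW hx'.1) ?_
    intro w' hw'
    rw [← h2] at hw'
    have : B' ≤ LinearMap.ker (φ x) := Submodule.span_le.2 hx'.2
    exact this hw'
  have ba : (B = W ∧ N = ⊥) → (FiniteDimensional ℚ (A ⧸ N.comap A.subtype) ∧
      Module.finrank ℚ (A ⧸ N.comap A.subtype) = Module.finrank K W) := by
    rintro ⟨h1, h2⟩
    refine ⟨hfd, ?_⟩
    have hb : N.comap A.subtype = ⊥ := by rw [h2]; exact A.ker_subtype
    let q : (A ⧸ N.comap A.subtype) ≃ₗ[ℚ] A := Submodule.quotEquivOfEqBot _ hb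
    have : FiniteDimensional ℚ A := Module.Finite.equiv q
    have hq := q.finrank_eq
    let b := Module.finBasis ℚ A
    have hs : B = Submodule.span K (Set.range fun i => (b i : V)) := by
      apply le_antisymm
      · rw [hB, Submodule.span_le]
        intro x hx
        have h3 := congrArg (Subtype.val) (b.sum_repr ⟨x, hx⟩)
        simp only [Submodule.coe_sum, Submodule.coe_smul] at h3
        rw [← h3]
        refine Submodule.sum_mem _ fun i _ => ?_
        rw [← algebraMap_smul K]
        exact Submodule.smul_mem _ _ (Submodule.subset_span ⟨i, rfl⟩)
      · apply Submodule.span_mono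
        rintro _ ⟨i, rfl⟩
        exact (b i).2
    have h5 := finrank_range_le_card (R := K) (fun i => (b i : V))
    rw [Set.finrank, ← hs, Fintype.card_fin] at h5
    rw [← h1]
    rw [← h1] at m1
    omega
  exact ⟨⟨fun h => cb (ac h), ba⟩, ⟨ac, fun h => ba (cb h)⟩, hI⟩

/-- Let `Γ` be a group, `V, V'` finite-dimensional `ℚ_ℓ`-vector
spaces with `Γ`-actions `ρ, ρ'` which are isomorphic as `Γ`-representations, and `⟨,⟩`
a nondegenerate `Γ`-invariant pairing `V × V' → ℚ_ℓ`.  Let `A ⊆ V^Γ` and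
`A' ⊆ (V')^Γ` be `ℚ`-subspaces pairing into `ℚ`, with `N, N'` their respective left and
right kernels.  With the conditions `T, T', I, I', E, E', S, S'` as in the statement,
the following are equivalent:
(a) `A/N` is finite-dimensional over `ℚ` with `dim_ℚ (A/N) = dim_{ℚ_ℓ} V^Γ`;
(b) `T ∧ E`;  (c) `T ∧ T' ∧ S`;  (d) `T ∧ T' ∧ E ∧ E' ∧ I ∧ I' ∧ S ∧ S'`.
Here `V^Γ` is realized as `⨅ σ, Ker (ρ σ - 1)` and the coinvariants `V_Γ` as the
quotient of `V` by the span of the elements `σ v - v`. -/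
theorem tate_conditions_equivalences
    (ℓ : ℕ) [Fact ℓ.Prime] (Γ : Type*) [Group Γ]
    (V V' : Type*) [AddCommGroup V] [AddCommGroup V']
    [Module ℚ_[ℓ] V] [Module ℚ_[ℓ] V']
    [FiniteDimensional ℚ_[ℓ] V] [FiniteDimensional ℚ_[ℓ] V']
    (ρ : Representation ℚ_[ℓ] Γ V) (ρ' : Representation ℚ_[ℓ] Γ V')
    (hiso : ∃ e : V ≃ₗ[ℚ_[ℓ]] V', ∀ (σ : Γ) (v : V), e (ρ σ v) = ρ' σ (e v))
    (φ : V →ₗ[ℚ_[ℓ]] V' →ₗ[ℚ_[ℓ]] ℚ_[ℓ])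
    (hnd₁ : ∀ v : V, (∀ v' : V', φ v v' = 0) → v = 0)
    (hnd₂ : ∀ v' : V', (∀ v : V, φ v v' = 0) → v' = 0)
    (hinv : ∀ (σ : Γ) (v : V) (v' : V'), φ (ρ σ v) (ρ' σ v') = φ v v') :
    letI : Module ℚ V := Module.compHom V (algebraMap ℚ ℚ_[ℓ])
    letI : Module ℚ V' := Module.compHom V' (algebraMap ℚ ℚ_[ℓ])
    letI VΓ : Submodule ℚ_[ℓ] V := ⨅ σ : Γ, LinearMap.ker (ρ σ - LinearMap.id)
    letI VΓ' : Submodule ℚ_[ℓ] V' := ⨅ σ : Γ, LinearMap.ker (ρ' σ - LinearMap.id)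
    letI coKer : Submodule ℚ_[ℓ] V :=
      Submodule.span ℚ_[ℓ] {x : V | ∃ (σ : Γ) (v : V), ρ σ v - v = x}
    letI coKer' : Submodule ℚ_[ℓ] V' :=
      Submodule.span ℚ_[ℓ] {x : V' | ∃ (σ : Γ) (v : V'), ρ' σ v - v = x}
    ∀ (A : Submodule ℚ V) (A' : Submodule ℚ V'),
      (∀ a ∈ A, ∀ σ : Γ, ρ σ a = a) → (∀ a' ∈ A', ∀ σ : Γ, ρ' σ a' = a') →
      (∀ a ∈ A, ∀ a' ∈ A', ∃ r : ℚ, φ a a' = (r : ℚ_[ℓ])) →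
      ∀ (N : Submodule ℚ V) (N' : Submodule ℚ V'),
        (∀ x : V, x ∈ N ↔ x ∈ A ∧ ∀ a' ∈ A', φ x a' = 0) →
        (∀ x' : V', x' ∈ N' ↔ x' ∈ A' ∧ ∀ a ∈ A, φ a x' = 0) →
        letI T : Prop := Submodule.span ℚ_[ℓ] (A : Set V) = VΓ
        letI T' : Prop := Submodule.span ℚ_[ℓ] (A' : Set V') = VΓ'
        letI I : Prop := ∀ (n : ℕ) (c : Fin n → ℚ_[ℓ]) (a : Fin n → V),
          (∀ i, a i ∈ A) → LinearIndependent ℚ a → ∑ i, c i • a i = 0 → ∀ i, c i = 0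
        letI I' : Prop := ∀ (n : ℕ) (c : Fin n → ℚ_[ℓ]) (a : Fin n → V'),
          (∀ i, a i ∈ A') → LinearIndependent ℚ a → ∑ i, c i • a i = 0 → ∀ i, c i = 0
        letI Econd : Prop := N = ⊥
        letI Econd' : Prop := N' = ⊥
        letI S : Prop := Function.Bijective (coKer.mkQ.comp VΓ.subtype)
        letI S' : Prop := Function.Bijective (coKer'.mkQ.comp VΓ'.subtype)
        letI acond : Prop := FiniteDimensional ℚ (A ⧸ N.comap A.subtype) ∧
          Module.finrank ℚ (A ⧸ N.comap A.subtype) = Module.finrank ℚ_[ℓ] VΓ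
        ((acond ↔ (T ∧ Econd)) ∧
          (acond ↔ (T ∧ T' ∧ S)) ∧
          (acond ↔ (T ∧ T' ∧ Econd ∧ Econd' ∧ I ∧ I' ∧ S ∧ S'))) := by
  letI : Module ℚ V := Module.compHom V (algebraMap ℚ ℚ_[ℓ])
  letI : Module ℚ V' := Module.compHom V' (algebraMap ℚ ℚ_[ℓ])
  let VΓ : Submodule ℚ_[ℓ] V := ⨅ σ : Γ, LinearMap.ker (ρ σ - LinearMap.id)
  let VΓ' : Submodule ℚ_[ℓ] V' := ⨅ σ : Γ, LinearMap.ker (ρ' σ - LinearMap.id)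
  let C : Submodule ℚ_[ℓ] V :=
    Submodule.span ℚ_[ℓ] {x : V | ∃ (σ : Γ) (v : V), ρ σ v - v = x}
  let C' : Submodule ℚ_[ℓ] V' :=
    Submodule.span ℚ_[ℓ] {x : V' | ∃ (σ : Γ) (v : V'), ρ' σ v - v = x}
  intro A A' hA hA' hr N N' hN hN'
  obtain ⟨e, he⟩ := hiso
  have hW : ∀ x, x ∈ VΓ ↔ ∀ σ, ρ σ x = x := by
    intro x
    simp [VΓ, Submodule.mem_iInf, sub_eq_zero]
  have hW' : ∀ x, x ∈ VΓ' ↔ ∀ σ, ρ' σ x = x := by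
    intro x
    simp [VΓ', Submodule.mem_iInf, sub_eq_zero]
  have hmap : VΓ.map (e : V →ₗ[ℚ_[ℓ]] V') = VΓ' := by
    ext y
    rw [Submodule.mem_map, hW']
    constructor
    · rintro ⟨x, hx, rfl⟩ σ
      have := he σ x
      rw [(hW x).1 hx σ] at this
      exact this.symm
    · intro h
      refine ⟨e.symm y, (hW _).2 fun σ => e.injective ?_, by simp⟩
      rw [he]
      simp [h]
  have hd : Module.finrank ℚ_[ℓ] VΓ = Module.finrank ℚ_[ℓ] VΓ' := by
    rw [← hmap]
    exact (LinearEquiv.finrank_map_eq e VΓ).symm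
  have hAW : (A : Set V) ⊆ VΓ := fun a ha => (hW a).2 (hA a ha)
  have hAW' : (A' : Set V') ⊆ VΓ' := fun a ha => (hW' a).2 (hA' a ha)
  have hS := aux_S ρ ρ' φ hnd₁ hnd₂ hinv VΓ VΓ' hW' hd C rfl
  have hS' := aux_S ρ' ρ φ.flip hnd₂ hnd₁ (fun σ v v' => hinv σ v' v) VΓ' VΓ hW hd.symm C' rfl
  obtain ⟨k1, k2, k3⟩ := aux_main φ A A' hr N hN VΓ VΓ' hAW hAW' hd
  obtain ⟨l1, l2, l3⟩ := aux_main φ.flip A' A (fun a ha a' ha' => hr a' ha' a ha) N' hN'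
    VΓ' VΓ hAW' hAW hd.symm
  have sw := aux_swap φ VΓ VΓ' hd
  refine ⟨k1, ?_, ?_⟩
  · rw [← hS] at k2
    exact k2
  · constructor
    · intro h
      obtain ⟨hT, hE⟩ := k1.1 h
      obtain ⟨-, hT', hnd⟩ := k2.1 h
      have hE' := (l1.1 (l2.2 ⟨hT', hT, sw hnd⟩)).2
      refine ⟨hT, hT', hE, hE', ?_, ?_, hS.2 hnd, hS'.2 (sw hnd)⟩
      · intro n c a ha hli h0
        exact Fintype.linearIndependent_iff.1 (k3 hE n a ha hli) c h0
      · intro n c a ha hli h0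
        exact Fintype.linearIndependent_iff.1 (l3 hE' n a ha hli) c h0
    · rintro ⟨hT, -, hE, -⟩
      exact k1.2 ⟨hT, hE⟩
end
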